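/- arXiv:0904.3957 — 3 statements merged into one kernel-verified Lean document; each statement's English description precedes it below -/
import Mathlib

section
/- There exists a ℂ[t]-algebra R which is flat as a ℂ[t]-module, such that R/(t−c)R is isomorphic as a ℂ-algebra to R(N_{k,2n}) = ℂ[M_{k,2n}]/I for every nonzero c ∈ ℂ, and R/tR is isomorphic as a ℂ-algebra to the Hibi algebra H_{D(N)} over the distributive lattice D(N); i.e., the coordinate ring of the nullcone N_{k,2n} is a flat deformation of H_{D(N)}. -/
noncomputable section

/-- One-line tableau predicate: `isTab n m I J` says `[I:J]` is a one-line tableau in `D(n,m)`,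
i.e. `I ⊆ {1,…,n}` and `J ⊆ {1,…,m}` are strictly increasing sequences of the same (positive) length. -/
def isTab (n m : ℕ) (I J : List ℕ) : Prop :=
  I.length = J.length ∧ I ≠ [] ∧ I.Chain' (· < ·) ∧ J.Chain' (· < ·) ∧
    (∀ x ∈ I, 1 ≤ x ∧ x ≤ n) ∧ ∀ x ∈ J, 1 ≤ x ∧ x ≤ m

/-- The tableau order `A ⪯ B` on one-line tableaux. -/
def tleq (A B : List ℕ × List ℕ) : Prop :=
  B.1.length ≤ A.1.length ∧
    ∀ r < B.1.length, A.1.getD r 0 ≤ B.1.getD r 0 ∧ A.2.getD r 0 ≤ B.2.getD r 0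

/-- The map ξ : `ξ([I:J]) = [j₁,…,jₕ, m+u₁,…,m+u_{n−h}]` where
`{n+1−u₁,…,n+1−u_{n−h}}` is the complement of `I` in `{1,…,n}`. -/
def xi (n m : ℕ) (I J : List ℕ) : List ℕ :=
  J ++ ((((List.range n).map (· + 1)).filter fun c => decide (c ∉ I)).reverse.map
      fun c => m + (n + 1 - c))

/-- The top element `[m+1, …, m+n]`. -/
def topL (n m : ℕ) : List ℕ := (List.range n).map fun r => m + r + 1

def xiInvI (n m : ℕ) (K : List ℕ) : List ℕ :=
  ((List.range n).map (· + 1)).filter fun i => decide (m + (n + 1 - i) ∉ K)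

def xiInvJ (m : ℕ) (K : List ℕ) : List ℕ := K.filter fun x => decide (x ≤ m)

/-- The meet `A ∧ B` in the distributive lattice `D(n,m)`, computed by transporting the
entrywise minimum through the order isomorphism ξ. -/
def tabMeet (n m : ℕ) (A B : List ℕ × List ℕ) : List ℕ × List ℕ :=
  (xiInvI n m (List.zipWith min (xi n m A.1 A.2) (xi n m B.1 B.2)),
    xiInvJ m (List.zipWith min (xi n m A.1 A.2) (xi n m B.1 B.2)))

/-- The join `A ∨ B` in the distributive lattice `D(n,m)`. -/
def tabJoin (n m : ℕ) (A B : List ℕ × List ℕ) : List ℕ × List ℕ :=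
  (xiInvI n m (List.zipWith max (xi n m A.1 A.2) (xi n m B.1 B.2)),
    xiInvJ m (List.zipWith max (xi n m A.1 A.2) (xi n m B.1 B.2)))

/-- `dmin n m I J` is the minor δ_{[I:J]} ∈ ℂ[M_{n,m}] : the determinant of the submatrix of
the generic n×m matrix of variables with rows `I` and columns `J` (1-based indices). -/
def dmin (n m : ℕ) (I J : List ℕ) : MvPolynomial (Fin n × Fin m) ℂ :=
  Matrix.det (Matrix.of fun a b : Fin I.length =>
    if h : I.getD a 0 - 1 < n ∧ J.getD b 0 - 1 < m then
      MvPolynomial.X (⟨I.getD a 0 - 1, h.1⟩, ⟨J.getD b 0 - 1, h.2⟩)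
    else 0)

/-- The basic symplectic invariant `r_{ij} = ∑_u (x_{i,2u−1}x_{j,2u} − x_{j,2u−1}x_{i,2u})`
(with 0-based variable indices). -/
def rbase (k n : ℕ) (i j : Fin k) : MvPolynomial (Fin k × Fin (2 * n)) ℂ :=
  ∑ u : Fin n,
    (MvPolynomial.X (i, ⟨2 * u.1, by have := u.isLt; omega⟩) *
        MvPolynomial.X (j, ⟨2 * u.1 + 1, by have := u.isLt; omega⟩) -
      MvPolynomial.X (j, ⟨2 * u.1, by have := u.isLt; omega⟩) *
        MvPolynomial.X (i, ⟨2 * u.1 + 1, by have := u.isLt; omega⟩))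

/-- The ideal `I` of the nullcone, generated by the basic symplectic invariants. -/
def sympIdeal (k n : ℕ) : Ideal (MvPolynomial (Fin k × Fin (2 * n)) ℂ) :=
  Ideal.span {f | ∃ i j : Fin k, i < j ∧ f = rbase k n i j}

/-- `Jtilde n J` means `J ⪰ J̃ = [1,3,…,2n−1]`, i.e. `ℓ(J) ≤ n` and the `r`-th entry of `J`
is at least `2r−1` (0-based: entry at index r is ≥ 2r+1). -/
def Jtilde (n : ℕ) (J : List ℕ) : Prop :=
  J.length ≤ n ∧ ∀ r < J.length, 2 * r + 1 ≤ J.getD r 0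

/-- `D(𝒩)` : one-line tableaux `[I:J] ∈ D(k,2n)` with `ℓ([I:J]) ≤ min(k,n)` and `J ⪰ J̃`. -/
def isTabN (k n : ℕ) (I J : List ℕ) : Prop :=
  isTab k (2 * n) I J ∧ I.length ≤ min k n ∧ Jtilde n J

open Classical in
/-- The variable `z_t` of the Hibi algebra when `t` belongs to the lattice, else `0`. -/
def hVar (P : List ℕ × List ℕ → Prop) (t : List ℕ × List ℕ) : MvPolynomial {s // P s} ℂ :=
  if h : P t then MvPolynomial.X ⟨t, h⟩ else 0

/-- The Hibi ideal `(z_x z_y − z_{x∧y} z_{x∨y})` for the lattice `{s // P s}` with meet `mt`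
and join `jn`; the Hibi algebra over the lattice is the corresponding quotient. -/
def hibiIdeal (P : List ℕ × List ℕ → Prop)
    (mt jn : List ℕ × List ℕ → List ℕ × List ℕ → List ℕ × List ℕ) :
    Ideal (MvPolynomial {s // P s} ℂ) :=
  Ideal.span {f | ∃ x y : {s // P s},
    f = MvPolynomial.X x * MvPolynomial.X y - hVar P (mt x.1 y.1) * hVar P (jn x.1 y.1)}

/-- `FlatDeform S₁ S₀` : a flat ℂ[t]-algebra with general fiber `S₁` (at each `t = c ≠ 0`)
and special fiber `S₀` (at `t = 0`). -/
structure FlatDeform (S₁ S₀ : Type) [CommRing S₁] [Algebra ℂ S₁] [CommRing S₀]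
    [Algebra ℂ S₀] : Type 1 where
  R : Type
  [cring : CommRing R]
  [algC : Algebra ℂ R]
  [algP : Algebra (Polynomial ℂ) R]
  [tower : IsScalarTower ℂ (Polynomial ℂ) R]
  flat : Module.Flat (Polynomial ℂ) R
  generic : ∀ c : ℂ, c ≠ 0 →
    Nonempty ((R ⧸ Ideal.span {(algebraMap (Polynomial ℂ) R) (Polynomial.X - Polynomial.C c)})
      ≃ₐ[ℂ] S₁)
  special : Nonempty ((R ⧸ Ideal.span {(algebraMap (Polynomial ℂ) R) Polynomial.X}) ≃ₐ[ℂ] S₀)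

section LeadingMonomials

open Finsupp MvPolynomial

variable {σ : Type} (wt : σ → ℤ)

/-- Polynomials all of whose monomials have weight at most `i`. -/
def weightLE (i : ℤ) : Submodule ℂ (MvPolynomial σ ℂ) where
  carrier := {f | ∀ d, i < weight wt d → coeff d f = 0}
  add_mem' hf hg d hd := by rw [coeff_add, hf d hd, hg d hd, add_zero]
  zero_mem' d _ := coeff_zero d
  smul_mem' c f hf d hd := by rw [coeff_smul, hf d hd, smul_zero]

variable {wt}

theorem weightLE_mono {i j : ℤ} (h : i ≤ j) : weightLE wt i ≤ weightLE wt j :=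
  fun _ hf d hd => hf d (h.trans_lt hd)

theorem mul_mem_weightLE {i j : ℤ} {f g : MvPolynomial σ ℂ} (hf : f ∈ weightLE wt i)
    (hg : g ∈ weightLE wt j) : f * g ∈ weightLE wt (i + j) := by
  classical
  intro d hd
  rw [coeff_mul]
  refine Finset.sum_eq_zero fun p hp => ?_
  have h := congrArg (weight wt) (Finset.HasAntidiagonal.mem_antidiagonal.mp hp)
  rw [map_add] at h
  by_cases h1 : i < weight wt p.1
  · rw [hf _ h1, zero_mul]
  · rw [hg _ (by omega), mul_zero]

theorem monomial_mem_weightLE {i : ℤ} {d : σ →₀ ℕ} (c : ℂ) (h : weight wt d ≤ i) :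
    monomial d c ∈ weightLE wt i := by
  classical
  intro e he
  rw [coeff_monomial, if_neg]
  rintro rfl
  omega

theorem X_mem_weightLE {i : ℤ} {s : σ} (h : wt s ≤ i) : X s ∈ weightLE wt i :=
  monomial_mem_weightLE 1 (by simpa [weight_single] using h)

theorem one_mem_weightLE {i : ℤ} (h : 0 ≤ i) : (1 : MvPolynomial σ ℂ) ∈ weightLE wt i :=
  monomial_mem_weightLE 1 (by simpa using h)

theorem prod_mem_weightLE {ι : Type*} (s : Finset ι) (f : ι → MvPolynomial σ ℂ) (w : ι → ℤ)
    (h : ∀ i ∈ s, f i ∈ weightLE wt (w i)) : ∏ i ∈ s, f i ∈ weightLE wt (∑ i ∈ s, w i) := by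
  classical
  induction s using Finset.induction_on with
  | empty => simpa using one_mem_weightLE le_rfl
  | insert a s ha ih =>
    rw [Finset.prod_insert ha, Finset.sum_insert ha]
    exact mul_mem_weightLE (h a (by simp)) (ih fun i hi => h i (by simp [hi]))

variable (wt) in
/-- `f` is the monomial `μ` plus terms of smaller weight. -/
def IsLead (f : MvPolynomial σ ℂ) (μ : σ →₀ ℕ) : Prop :=
  f - monomial μ 1 ∈ weightLE wt (weight wt μ - 1)

theorem IsLead.mem {f : MvPolynomial σ ℂ} {μ : σ →₀ ℕ} (h : IsLead wt f μ) :
    f ∈ weightLE wt (weight wt μ) := by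
  rw [← sub_add_cancel f (monomial μ 1)]
  exact add_mem (weightLE_mono (by omega) h) (monomial_mem_weightLE 1 le_rfl)

theorem IsLead.coeff_self {f : MvPolynomial σ ℂ} {μ : σ →₀ ℕ} (h : IsLead wt f μ) :
    coeff μ f = 1 := by
  classical
  have := h μ (by omega)
  rw [coeff_sub, coeff_monomial, if_pos rfl] at this
  linear_combination this

theorem IsLead.coeff_of_ne {f : MvPolynomial σ ℂ} {μ ν : σ →₀ ℕ} (h : IsLead wt f μ)
    (hw : weight wt μ ≤ weight wt ν) (hne : μ ≠ ν) : coeff ν f = 0 := by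
  classical
  have := h ν (by omega)
  rw [coeff_sub, coeff_monomial, if_neg hne] at this
  linear_combination this

theorem isLead_one : IsLead wt 1 0 := by
  unfold IsLead
  rw [show (1 : MvPolynomial σ ℂ) = monomial 0 1 from rfl, sub_self]
  exact zero_mem _

theorem IsLead.mul {f g : MvPolynomial σ ℂ} {μ ν : σ →₀ ℕ} (hf : IsLead wt f μ)
    (hg : IsLead wt g ν) : IsLead wt (f * g) (μ + ν) := by
  have h : f * g - monomial (μ + ν) 1 =
      (f - monomial μ 1) * g + monomial μ 1 * (g - monomial ν 1) := by
    rw [show (monomial (μ + ν) 1 : MvPolynomial σ ℂ) = monomial μ 1 * monomial ν 1 by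
      rw [monomial_mul, one_mul]]
    ring
  unfold IsLead
  rw [h, map_add]
  refine add_mem (weightLE_mono ?_ (mul_mem_weightLE hf hg.mem))
    (weightLE_mono ?_ (mul_mem_weightLE (monomial_mem_weightLE 1 le_rfl) hg)) <;> omega

theorem IsLead.multiset_prod {D : Type*} {F : D → MvPolynomial σ ℂ} {μ : D → σ →₀ ℕ}
    (h : ∀ x, IsLead wt (F x) (μ x)) (s : Multiset D) :
    IsLead wt (s.map F).prod (s.map μ).sum := by
  induction s using Multiset.induction_on with
  | empty => simpa using isLead_one
  | cons a s ih => simpa using (h a).mul ih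

/-- Elements with distinct leading monomials do not cancel. -/
theorem weight_le_of_sum_mem {T : Type*} {F : T → MvPolynomial σ ℂ} {μ : T → σ →₀ ℕ}
    (hlead : ∀ t, IsLead wt (F t) (μ t)) (hinj : Function.Injective μ) {i : ℤ} (c : T →₀ ℂ)
    (hc : c.sum (fun t a => a • F t) ∈ weightLE wt i) {t : T} (ht : t ∈ c.support) :
    weight wt (μ t) ≤ i := by
  by_contra! hlt
  obtain ⟨u, hu, hmax⟩ := Finset.exists_max_image c.support (fun t => weight wt (μ t)) ⟨t, ht⟩
  have h0 := hc (μ u) (hlt.trans_le (hmax t ht))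
  rw [Finsupp.sum, coeff_sum, Finset.sum_eq_single u] at h0
  · rw [coeff_smul, (hlead u).coeff_self, smul_eq_mul, mul_one] at h0
    exact (Finsupp.mem_support_iff.mp hu) h0
  · intro v hv hvu
    rw [coeff_smul, (hlead v).coeff_of_ne (hmax v hv) (fun h => hvu (hinj h)), smul_zero]
  · intro h; exact absurd hu h

end LeadingMonomials

section Rees

open Polynomial

variable {σ : Type} (wt : σ → ℤ) {A : Type} [CommRing A] [Algebra ℂ A]
  (φ : A →ₐ[ℂ] MvPolynomial σ ℂ)

/-- The Rees algebra of the filtration on `A` pulled back along `φ` from the weight filtration. -/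
def reesSubalgebra : Subalgebra ℂ A[X] where
  carrier := {f | ∀ i : ℕ, φ (f.coeff i) ∈ weightLE wt i}
  add_mem' hf hg i := by rw [coeff_add, map_add]; exact add_mem (hf i) (hg i)
  mul_mem' {f g} hf hg i := by
    rw [coeff_mul, map_sum]
    refine sum_mem fun p hp => ?_
    rw [map_mul, ← Finset.HasAntidiagonal.mem_antidiagonal.mp hp, Nat.cast_add]
    exact mul_mem_weightLE (hf _) (hg _)
  algebraMap_mem' c i := by
    rw [Polynomial.algebraMap_apply, coeff_C]
    split_ifs with h
    · rw [AlgHom.commutes, Algebra.algebraMap_eq_smul_one]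
      exact Submodule.smul_mem _ _ (one_mem_weightLE (by omega))
    · rw [map_zero]; exact zero_mem _

theorem monomial_mem_reesSubalgebra {a : A} {i : ℕ} (h : φ a ∈ weightLE wt i) :
    monomial i a ∈ reesSubalgebra wt φ := by
  intro j
  rw [coeff_monomial]
  split_ifs with hij
  · rwa [← hij]
  · rw [map_zero]; exact zero_mem _

/-- The parameter `t` of the Rees algebra. -/
def reesT : reesSubalgebra wt φ :=
  ⟨monomial 1 1, monomial_mem_reesSubalgebra wt φ (by
    rw [map_one]; exact one_mem_weightLE (by omega))⟩

theorem reesT_mul_coeff_zero (f : reesSubalgebra wt φ) :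
    (reesT wt φ * f : reesSubalgebra wt φ).1.coeff 0 = 0 := by
  simp [reesT]

theorem reesT_mul_coeff_succ (f : reesSubalgebra wt φ) (i : ℕ) :
    (reesT wt φ * f : reesSubalgebra wt φ).1.coeff (i + 1) = f.1.coeff i := by
  simp [reesT, monomial_one_one_eq_X, coeff_X_mul]

/-- The specialization `t ↦ c`. -/
def reesEval (c : ℂ) : reesSubalgebra wt φ →ₐ[ℂ] A :=
  ((aeval (algebraMap ℂ A c) : A[X] →ₐ[A] A).restrictScalars ℂ).comp
    (reesSubalgebra wt φ).val

theorem reesEval_apply (c : ℂ) (f : reesSubalgebra wt φ) :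
    reesEval wt φ c f = f.1.eval (algebraMap ℂ A c) := by
  simp [reesEval]

theorem reesEval_surjective {c : ℂ} (hc : c ≠ 0) : Function.Surjective (reesEval wt φ c) := by
  intro a
  obtain ⟨i, hi⟩ : ∃ i : ℕ, φ a ∈ weightLE wt i := by
    refine ⟨(∑ d ∈ (φ a).support, |Finsupp.weight wt d|).toNat, fun d hd => ?_⟩
    by_contra hne
    have h1 := Finset.single_le_sum (f := fun d => |Finsupp.weight wt d|)
      (fun _ _ => abs_nonneg _) (MvPolynomial.mem_support_iff.mpr hne)
    have h2 := le_abs_self (Finsupp.weight wt d)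
    omega
  refine ⟨⟨monomial i ((c⁻¹) ^ i • a), monomial_mem_reesSubalgebra wt φ (by
    rw [map_smul]; exact Submodule.smul_mem _ _ hi)⟩, ?_⟩
  rw [reesEval_apply, eval_monomial, ← map_pow, mul_comm, ← Algebra.smul_def, smul_smul,
    ← mul_pow, mul_inv_cancel₀ hc, one_pow, one_smul]

theorem ker_reesEval {c : ℂ} (hc : c ≠ 0) :
    RingHom.ker (reesEval wt φ c) =
      Ideal.span {reesT wt φ - algebraMap ℂ (reesSubalgebra wt φ) c} := by
  apply le_antisymm
  · intro f hf
    rw [RingHom.mem_ker, reesEval_apply] at hf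
    obtain ⟨g, hg⟩ := (dvd_iff_isRoot (p := f.1)).mpr hf
    have hmem : g ∈ reesSubalgebra wt φ := by
      intro i
      have key : ∀ j : ℕ, φ (f.1.coeff j) ∈ weightLE wt j := f.2
      induction i with
      | zero =>
        have h := key 0
        rw [hg, sub_mul, coeff_sub, coeff_X_mul_zero, coeff_C_mul, zero_sub, map_neg, map_mul,
          AlgHom.commutes, ← Algebra.smul_def, neg_mem_iff] at h
        simpa [smul_smul, inv_mul_cancel₀ hc] using Submodule.smul_mem _ c⁻¹ h
      | succ i ih =>
        have h := key (i + 1)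
        rw [hg, sub_mul, coeff_sub, coeff_X_mul, coeff_C_mul, map_sub, map_mul,
          AlgHom.commutes, ← Algebra.smul_def] at h
        have h2 := sub_mem (weightLE_mono (by omega) ih) h
        rw [sub_sub_cancel] at h2
        simpa [smul_smul, inv_mul_cancel₀ hc] using Submodule.smul_mem _ c⁻¹ h2
    refine Ideal.mem_span_singleton.mpr ⟨⟨g, hmem⟩, Subtype.ext ?_⟩
    rw [hg]
    simp [reesT, monomial_one_one_eq_X, Polynomial.algebraMap_apply]
  · rw [Ideal.span_singleton_le_iff_mem, RingHom.mem_ker, reesEval_apply]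
    simp [reesT, monomial_one_one_eq_X, Polynomial.algebraMap_apply]

theorem reesAlgebra_flat [Algebra ℂ[X] (reesSubalgebra wt φ)]
    (hφ : Function.Injective φ)
    (hT : algebraMap ℂ[X] (reesSubalgebra wt φ) =
      (aeval (reesT wt φ) : ℂ[X] →ₐ[ℂ] reesSubalgebra wt φ).toRingHom) :
    Module.Flat ℂ[X] (reesSubalgebra wt φ) := by
  have : IsDomain A := hφ.isDomain φ.toRingHom
  have : Module.IsTorsionFree ℂ[X] (reesSubalgebra wt φ) := by
    rw [Module.isTorsionFree_iff_algebraMap_injective, hT]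
    have h : ∀ p : ℂ[X], (aeval (reesT wt φ) p : reesSubalgebra wt φ).1 =
        p.map (algebraMap ℂ A) := by
      intro p
      have h1 : (aeval (reesT wt φ) p : reesSubalgebra wt φ).1 = aeval (X : A[X]) p := by
        rw [← Subalgebra.coe_val, ← AlgHom.comp_apply, ← aeval_algHom]
        simp [reesT, monomial_one_one_eq_X]
      rw [h1, aeval_X_left_eq_map]
    intro p q hpq
    apply map_injective (algebraMap ℂ A) (algebraMap ℂ A).injective
    rw [← h, ← h]
    exact congrArg Subtype.val hpq
  infer_instance

/-- A commutative algebra with generators `δ x`, indexed by a distributive lattice, whose standard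
monomials span and have distinct leading monomials, multiplicative along the lattice operations, is
a flat deformation of the Hibi algebra. -/
theorem flatDeform_of_leading {wt} {φ : A →ₐ[ℂ] MvPolynomial σ ℂ} {D : Type} {δ : D → A}
    {μ : D → σ →₀ ℕ} {std : Multiset D → Prop}
    (hlead : ∀ x, IsLead wt (φ (δ x)) (μ x)) (hpos : ∀ x, 0 < Finsupp.weight wt (μ x))
    (hinj : ∀ s t, std s → std t → (s.map μ).sum = (t.map μ).sum → s = t)
    {mt jn : D → D → D} (hmod : ∀ x y, μ (mt x y) + μ (jn x y) = μ x + μ y)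
    (hstd : ∀ a : A, a ∈ Submodule.span ℂ {b | ∃ s, std s ∧ b = (s.map δ).prod})
    {J : Ideal (MvPolynomial D ℂ)}
    (hJ : J = Ideal.span {f | ∃ x y, f = MvPolynomial.X x * MvPolynomial.X y -
      MvPolynomial.X (mt x y) * MvPolynomial.X (jn x y)})
    (hHibi : ∀ f : MvPolynomial D ℂ ⧸ J, f ∈ Submodule.span ℂ
      {b | ∃ s, std s ∧ b = (s.map fun x => Ideal.Quotient.mk J (MvPolynomial.X x)).prod}) :
    Nonempty (FlatDeform A (MvPolynomial D ℂ ⧸ J)) := by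
  classical
  set M : {s // std s} → A := fun s => (s.1.map δ).prod with hM
  set ν : {s // std s} → σ →₀ ℕ := fun s => (s.1.map μ).sum with hν
  have hνinj : Function.Injective ν := fun s t h => Subtype.ext (hinj _ _ s.2 t.2 h)
  have hlead' : ∀ s : Multiset D, IsLead wt (φ (s.map δ).prod) (s.map μ).sum := by
    intro s
    rw [map_multiset_prod, Multiset.map_map]
    exact IsLead.multiset_prod hlead s
  have hleadM : ∀ s, IsLead wt (φ (M s)) (ν s) := fun s => hlead' s.1
  have hfin : ∀ a, ∃ c : {s // std s} →₀ ℂ, (c.sum fun t x => x • M t) = a := by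
    intro a
    rw [← Finsupp.mem_span_range_iff_exists_finsupp]
    convert hstd a using 2
    ext b
    simp [hM, eq_comm]
  have hfinJ : ∀ f : MvPolynomial D ℂ ⧸ J, ∃ c : {s // std s} →₀ ℂ,
      (c.sum fun t x => x • Ideal.Quotient.mkₐ ℂ J (t.1.map MvPolynomial.X).prod) = f := by
    intro a
    rw [← Finsupp.mem_span_range_iff_exists_finsupp]
    convert hHibi a using 2
    ext b
    simp [map_multiset_prod, eq_comm]
  have hφsum : ∀ c : {s // std s} →₀ ℂ, φ (c.sum fun t x => x • M t) =
      c.sum fun t x => x • φ (M t) := by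
    intro c; simp [Finsupp.sum, map_sum]
  have hφ : Function.Injective φ := by
    rw [injective_iff_map_eq_zero]
    intro a ha
    obtain ⟨c, rfl⟩ := hfin a
    rw [hφsum] at ha
    have hc : c.support = ∅ := by
      rw [Finset.eq_empty_iff_forall_notMem]
      intro t ht
      have := weight_le_of_sum_mem hleadM hνinj (i := Finsupp.weight wt (ν t) - 1) c
        (by rw [ha]; exact zero_mem _) ht
      omega
    rw [Finsupp.support_eq_empty] at hc
    simp [hc]
  let algP : Algebra ℂ[X] (reesSubalgebra wt φ) :=
    (aeval (reesT wt φ) : ℂ[X] →ₐ[ℂ] reesSubalgebra wt φ).toRingHom.toAlgebra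
  have hT : algebraMap ℂ[X] (reesSubalgebra wt φ) =
      (aeval (reesT wt φ) : ℂ[X] →ₐ[ℂ] reesSubalgebra wt φ).toRingHom := rfl
  have hTX : algebraMap ℂ[X] (reesSubalgebra wt φ) X = reesT wt φ := by
    rw [hT]; exact aeval_X _
  have tower : IsScalarTower ℂ ℂ[X] (reesSubalgebra wt φ) := by
    refine IsScalarTower.of_algebraMap_eq fun c => ?_
    rw [hT]
    exact ((aeval (reesT wt φ) : ℂ[X] →ₐ[ℂ] reesSubalgebra wt φ).commutes c).symm
  set wn : D → ℕ := fun x => (Finsupp.weight wt (μ x)).toNat with hwn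
  have hwn' : ∀ x, (wn x : ℤ) = Finsupp.weight wt (μ x) := fun x =>
    Int.toNat_of_nonneg (hpos x).le
  have hW : ∀ s : Multiset D, (((s.map wn).sum : ℕ) : ℤ) = Finsupp.weight wt (s.map μ).sum := by
    intro s
    induction s using Multiset.induction_on with
    | empty => simp
    | cons a s ih => simp [ih, hwn']
  have hmonmem : ∀ s : Multiset D,
      monomial (s.map wn).sum (s.map δ).prod ∈ reesSubalgebra wt φ := by
    intro s
    apply monomial_mem_reesSubalgebra
    rw [hW]
    exact (hlead' s).mem
  set z : D → reesSubalgebra wt φ := fun x => ⟨monomial (wn x) (δ x),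
    monomial_mem_reesSubalgebra wt φ (by rw [hwn']; exact (hlead x).mem)⟩ with hz
  set Ψ : MvPolynomial D ℂ →ₐ[ℂ] reesSubalgebra wt φ := MvPolynomial.aeval z with hΨ
  have hΨs : ∀ s : Multiset D, (Ψ (s.map MvPolynomial.X).prod) =
      ⟨monomial (s.map wn).sum (s.map δ).prod, hmonmem s⟩ := by
    intro s
    induction s using Multiset.induction_on with
    | empty => ext1; simp
    | cons a s ih =>
      rw [Multiset.map_cons, Multiset.prod_cons, map_mul, ih]
      ext1
      simp [hΨ, hz, monomial_mul_monomial]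
  set I₀ : Ideal (reesSubalgebra wt φ) := Ideal.span {reesT wt φ} with hI₀
  set Θ : MvPolynomial D ℂ →ₐ[ℂ] reesSubalgebra wt φ ⧸ I₀ :=
    (Ideal.Quotient.mkₐ ℂ I₀).comp Ψ with hΘ
  have hJΘ : ∀ f ∈ J, Θ f = 0 := by
    intro f hf
    rw [← RingHom.mem_ker]
    revert f
    change J ≤ _
    rw [hJ, Ideal.span_le]
    rintro _ ⟨x, y, rfl⟩
    rw [SetLike.mem_coe, RingHom.mem_ker]
    have hw : wn (mt x y) + wn (jn x y) = wn x + wn y := by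
      have := congrArg (Finsupp.weight wt) (hmod x y)
      rw [map_add, map_add] at this
      have h1 := hwn' x; have h2 := hwn' y; have h3 := hwn' (mt x y); have h4 := hwn' (jn x y)
      omega
    have hp : 0 < wn x := by have := hpos x; have := hwn' x; omega
    have hmem : φ (δ x * δ y - δ (mt x y) * δ (jn x y)) ∈
        weightLE wt ((wn x + wn y - 1 : ℕ) : ℤ) := by
      have h1 := (hlead x).mul (hlead y)
      have h2 := (hlead (mt x y)).mul (hlead (jn x y))
      rw [hmod] at h2
      unfold IsLead at h1 h2
      have h3 := sub_mem h1 h2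
      rw [sub_sub_sub_cancel_right, map_add, ← hwn', ← hwn'] at h3
      rw [map_sub, map_mul, map_mul]
      refine weightLE_mono ?_ h3
      omega
    have key : Ψ (MvPolynomial.X x * MvPolynomial.X y -
        MvPolynomial.X (mt x y) * MvPolynomial.X (jn x y)) =
        reesT wt φ * ⟨_, monomial_mem_reesSubalgebra wt φ hmem⟩ := by
      ext1
      simp only [hΨ, hz, map_sub, map_mul, MvPolynomial.aeval_X, reesT, MulMemClass.mk_mul_mk,
        monomial_mul_monomial, AddSubgroupClass.coe_sub, hw]
      rw [← map_sub, ← map_sub, monomial_mul_monomial, one_mul,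
        show 1 + (wn x + wn y - 1) = wn x + wn y by omega]
    rw [hΘ, AlgHom.comp_apply, key, Ideal.Quotient.mkₐ_eq_mk, Ideal.Quotient.eq_zero_iff_mem]
    exact Ideal.mul_mem_right _ _ (Ideal.mem_span_singleton_self _)
  set Λ := Ideal.Quotient.liftₐ J Θ hJΘ with hΛ
  have hΛmk : ∀ f, Λ (Ideal.Quotient.mkₐ ℂ J f) = Θ f := fun f => rfl
  have hinjΛ : Function.Injective Λ := by
    rw [injective_iff_map_eq_zero]
    intro f hf
    obtain ⟨c, rfl⟩ := hfinJ f
    have hc : c.support = ∅ := by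
      rw [Finset.eq_empty_iff_forall_notMem]
      intro t ht
      have h1 : Λ (c.sum fun t x => x • Ideal.Quotient.mkₐ ℂ J (t.1.map MvPolynomial.X).prod) =
          Ideal.Quotient.mkₐ ℂ I₀ (c.sum fun t x => x • Ψ (t.1.map MvPolynomial.X).prod) := by
        simp only [Finsupp.sum, map_sum, map_smul, hΛmk, hΘ, AlgHom.comp_apply]
      rw [h1, Ideal.Quotient.mkₐ_eq_mk, Ideal.Quotient.eq_zero_iff_mem,
        Ideal.mem_span_singleton] at hf
      obtain ⟨g, hg⟩ := hf
      set W := (t.1.map wn).sum with hWt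
      have h2 : φ ((reesT wt φ * g).1.coeff W) ∈ weightLE wt (W - 1 : ℤ) := by
        cases W with
        | zero => rw [reesT_mul_coeff_zero, map_zero]; exact zero_mem _
        | succ i =>
          rw [reesT_mul_coeff_succ]
          exact weightLE_mono (by push_cast; omega) (g.2 i)
      rw [← hg] at h2
      have h3 : (c.sum fun t x => x • Ψ (t.1.map MvPolynomial.X).prod).1.coeff W =
          (c.filter fun t => (t.1.map wn).sum = W).sum fun t x => x • M t := by
        rw [Finsupp.sum_filter_index, Finsupp.sum, Finsupp.support_filter, Finset.sum_filter]
        rw [← Subalgebra.coe_val, map_sum, finsetSum_coeff]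
        refine Finset.sum_congr rfl fun s _ => ?_
        rw [hΨs, map_smul, Subalgebra.coe_val, coeff_smul, coeff_monomial]
        split_ifs <;> simp [hM]
      rw [h3, hφsum] at h2
      have := weight_le_of_sum_mem hleadM hνinj _ h2 (t := t) (by
        rw [Finsupp.support_filter, Finset.mem_filter]; exact ⟨ht, rfl⟩)
      have h4 := hW t.1
      simp only [hν] at this
      omega
    rw [Finsupp.support_eq_empty] at hc
    simp [hc]
  have hsurΛ : Function.Surjective Λ := by
    have hmon : ∀ (i : ℕ) (a : A), a ∈ Submodule.span ℂ {b | ∃ s : Multiset D,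
        (s.map wn).sum ≤ i ∧ b = (s.map δ).prod} → ∃ h : φ a ∈ weightLE wt i,
        Ideal.Quotient.mkₐ ℂ I₀ ⟨_, monomial_mem_reesSubalgebra wt φ h⟩ ∈ Λ.range := by
      intro i a ha
      induction ha using Submodule.span_induction with
      | mem a ha =>
        obtain ⟨s, hs, rfl⟩ := ha
        have hmem : φ (s.map δ).prod ∈ weightLE wt (s.map wn).sum := by
          rw [hW]; exact (hlead' s).mem
        refine ⟨weightLE_mono (by exact_mod_cast hs) hmem, ?_⟩
        rcases hs.eq_or_lt with h | h
        · refine ⟨Ideal.Quotient.mkₐ ℂ J (s.map MvPolynomial.X).prod, ?_⟩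
          change Λ _ = _
          rw [hΛmk, hΘ, AlgHom.comp_apply, hΨs]
          congr 2
          rw [h]
        · have h5 : φ (s.map δ).prod ∈ weightLE wt ((i - 1 : ℕ) : ℤ) :=
            weightLE_mono (by omega) hmem
          have h6 : (⟨monomial i (s.map δ).prod, monomial_mem_reesSubalgebra wt φ
              (weightLE_mono (by exact_mod_cast hs) hmem)⟩ : reesSubalgebra wt φ) =
              reesT wt φ * ⟨_, monomial_mem_reesSubalgebra wt φ h5⟩ := by
            ext1
            simp only [reesT, MulMemClass.mk_mul_mk, monomial_mul_monomial, one_mul]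
            rw [show 1 + (i - 1) = i by omega]
          rw [h6, Ideal.Quotient.mkₐ_eq_mk, Ideal.Quotient.eq_zero_iff_mem.mpr
            (Ideal.mul_mem_right _ _ (Ideal.mem_span_singleton_self _))]
          exact zero_mem _
      | zero =>
        refine ⟨by rw [map_zero]; exact zero_mem _, ⟨0, ?_⟩⟩
        rw [map_zero]
        symm
        convert map_zero (Ideal.Quotient.mkₐ ℂ I₀)
        simp
      | add a b _ _ iha ihb =>
        obtain ⟨ha, ha'⟩ := iha
        obtain ⟨hb, hb'⟩ := ihb
        refine ⟨by rw [map_add]; exact add_mem ha hb, ?_⟩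
        convert add_mem ha' hb'
        rw [← map_add (Ideal.Quotient.mkₐ ℂ I₀)]
        congr 1
        ext1
        simp
      | smul x a _ iha =>
        obtain ⟨ha, ha'⟩ := iha
        refine ⟨by rw [map_smul]; exact Submodule.smul_mem _ _ ha, ?_⟩
        convert Subalgebra.smul_mem _ ha' x
        rw [← map_smul (Ideal.Quotient.mkₐ ℂ I₀)]
        congr 1
        ext1
        exact (smul_monomial x i a).symm
    intro r
    obtain ⟨f, rfl⟩ := Ideal.Quotient.mkₐ_surjective ℂ I₀ r
    have hsum : f = ∑ i ∈ f.1.support,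
        ⟨monomial i (f.1.coeff i), monomial_mem_reesSubalgebra wt φ (f.2 i)⟩ := by
      ext1
      rw [AddSubmonoidClass.coe_finsetSum]
      exact f.1.as_sum_support
    have hsum' := congrArg (Ideal.Quotient.mkₐ ℂ I₀) hsum
    rw [map_sum] at hsum'
    change _ ∈ Λ.range
    rw [hsum']
    refine Subalgebra.sum_mem _ fun i _ => ?_
    obtain ⟨c, hc⟩ := hfin (f.1.coeff i)
    refine (hmon i (f.1.coeff i) ?_).2
    have h7 := f.2 i
    rw [← hc, hφsum] at h7
    rw [← hc]
    refine Submodule.sum_mem _ fun t ht => Submodule.smul_mem _ _ (Submodule.subset_span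
      ⟨t.1, ?_, rfl⟩)
    have h8 := weight_le_of_sum_mem hleadM hνinj c h7 ht
    have h9 := hW t.1
    simp only [hν] at h8
    omega
  refine ⟨⟨reesSubalgebra wt φ, reesAlgebra_flat wt φ hφ hT, ?_, ?_⟩⟩
  · intro c hc
    have h : algebraMap ℂ[X] (reesSubalgebra wt φ) (X - C c) =
        reesT wt φ - algebraMap ℂ (reesSubalgebra wt φ) c := by
      rw [map_sub, hTX, IsScalarTower.algebraMap_apply ℂ ℂ[X] (reesSubalgebra wt φ)]
      rfl
    rw [h]
    exact ⟨(Ideal.quotientEquivAlgOfEq ℂ (ker_reesEval wt φ hc).symm).trans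
      (Ideal.quotientKerAlgEquivOfSurjective (reesEval_surjective wt φ hc))⟩
  · rw [hTX]
    exact ⟨(AlgEquiv.ofBijective Λ ⟨hinjΛ, hsurΛ⟩).symm⟩

end Rees

section Straightening

/-- If products of non-comparable generators, and generators outside `L`, can be rewritten in terms
of generators with larger sums of squares of `ρ`, then every product of generators is a combination
of products along chains in `L`. -/
theorem prod_mem_span_chains {X B : Type*} [CommRing B] [Algebra ℂ B] (d : X → B) (ρ : X → ℕ)
    (E L : Set X) {le : X → X → Prop} (hrefl : ∀ x, le x x) {m : ℕ} (hm : ∀ x ∈ E, ρ x ≤ m)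
    (h1 : ∀ x ∈ E, x ∉ L → d x ∈ Submodule.span ℂ {b | ∃ y ∈ E, ρ x < ρ y ∧ b = d y})
    (h2 : ∀ x ∈ E, ∀ y ∈ E, ¬ le x y → ¬ le y x → d x * d y ∈ Submodule.span ℂ
      {b | ∃ u ∈ E, ∃ v ∈ E, ρ x ^ 2 + ρ y ^ 2 < ρ u ^ 2 + ρ v ^ 2 ∧ b = d u * d v})
    (s : Multiset X) (hs : ∀ x ∈ s, x ∈ E) :
    (s.map d).prod ∈ Submodule.span ℂ {b | ∃ t : Multiset X, (∀ x ∈ t, x ∈ E ∧ x ∈ L) ∧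
      (∀ x ∈ t, ∀ y ∈ t, le x y ∨ le y x) ∧ b = (t.map d).prod} := by
  classical
  have hmul : ∀ {T : Set B} {a c : B} {S : Submodule ℂ B}, a ∈ Submodule.span ℂ T →
      (∀ b ∈ T, b * c ∈ S) → a * c ∈ S := by
    intro T a c S ha h
    induction ha using Submodule.span_induction with
    | mem b hb => exact h b hb
    | zero => rw [zero_mul]; exact zero_mem _
    | add x y _ _ hx hy => rw [add_mul]; exact add_mem hx hy
    | smul r x _ hx => rw [smul_mul_assoc]; exact Submodule.smul_mem _ _ hx
  have hbound : ∀ s : Multiset X, (∀ x ∈ s, x ∈ E) →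
      (s.map fun x => ρ x ^ 2).sum ≤ s.card * m ^ 2 := by
    intro s hs
    have := Multiset.sum_le_card_nsmul (s.map fun x => ρ x ^ 2) (m ^ 2) (by
      intro y hy
      obtain ⟨x, hx, rfl⟩ := Multiset.mem_map.mp hy
      exact Nat.pow_le_pow_left (hm x (hs x hx)) 2)
    simpa using this
  induction hN : s.card * m ^ 2 - (s.map fun x => ρ x ^ 2).sum using Nat.strong_induction_on
    generalizing s with
  | _ N ih =>
    by_cases hL : ∃ x ∈ s, x ∉ L
    · obtain ⟨x, hxs, hxL⟩ := hL
      obtain ⟨t, rfl⟩ := Multiset.exists_cons_of_mem hxs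
      rw [Multiset.map_cons, Multiset.prod_cons]
      refine hmul (h1 x (hs x hxs) hxL) ?_
      rintro _ ⟨y, hy, hxy, rfl⟩
      have hE : ∀ z ∈ y ::ₘ t, z ∈ E := by
        intro z hz
        rcases Multiset.mem_cons.mp hz with rfl | hz
        · exact hy
        · exact hs z (Multiset.mem_cons_of_mem hz)
      have hb := hbound _ hE
      have hsq : ρ x ^ 2 < ρ y ^ 2 := Nat.pow_lt_pow_left hxy two_ne_zero
      rw [← Multiset.prod_cons, ← Multiset.map_cons]
      refine ih _ ?_ _ hE rfl
      simp only [Multiset.map_cons, Multiset.sum_cons, Multiset.card_cons] at hb hN ⊢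
      omega
    · push Not at hL
      by_cases hc : ∀ x ∈ s, ∀ y ∈ s, le x y ∨ le y x
      · exact Submodule.subset_span ⟨s, fun x hx => ⟨hs x hx, hL x hx⟩, hc, rfl⟩
      · push Not at hc
        obtain ⟨x, hxs, y, hys, hxy, hyx⟩ := hc
        obtain ⟨t, rfl⟩ := Multiset.exists_cons_of_mem hxs
        have hyt : y ∈ t := (Multiset.mem_cons.mp hys).resolve_left
          (fun h => hxy (h ▸ hrefl _))
        obtain ⟨t, rfl⟩ := Multiset.exists_cons_of_mem hyt
        rw [Multiset.map_cons, Multiset.map_cons, Multiset.prod_cons, Multiset.prod_cons,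
          ← mul_assoc]
        refine hmul (h2 x (hs x hxs) y (hs y hys) hxy hyx) ?_
        rintro _ ⟨u, hu, v, hv, huv, rfl⟩
        have hE : ∀ z ∈ u ::ₘ v ::ₘ t, z ∈ E := by
          intro z hz
          rcases Multiset.mem_cons.mp hz with rfl | hz
          · exact hu
          rcases Multiset.mem_cons.mp hz with rfl | hz
          · exact hv
          · exact hs z (Multiset.mem_cons_of_mem (Multiset.mem_cons_of_mem hz))
        have hb := hbound _ hE
        rw [mul_assoc, ← Multiset.prod_cons, ← Multiset.prod_cons, ← Multiset.map_cons,
          ← Multiset.map_cons]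
        refine ih _ ?_ _ hE rfl
        simp only [Multiset.map_cons, Multiset.sum_cons, Multiset.card_cons] at hb hN ⊢
        omega

end Straightening

section Minors

open TensorProduct

variable {k : ℕ}

/-- Strictly increasing `k`-tuples of column indices below `N`. -/
def columnSets (k N : ℕ) : Set (Fin k → ℕ) := {K | StrictMono K ∧ ∀ r, K r < N}

/-- The tuple `f` viewed as a binary number; larger columns dominate. -/
def binWeight (f : Fin k → ℕ) : ℕ := ∑ r, 2 ^ f r

theorem binWeight_le {N : ℕ} {f : Fin k → ℕ} (hf : ∀ r, f r < N) : binWeight f ≤ k * 2 ^ N := by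
  unfold binWeight
  refine (Finset.sum_le_card_nsmul _ _ (2 ^ N) fun r _ =>
    Nat.pow_le_pow_right two_pos (hf r).le).trans ?_
  simp

variable {A : Type*} [CommRing A] (y : ℕ → Fin k → A)

/-- The maximal minor with columns `y (f i)`. -/
def maxMinor (f : Fin k → ℕ) : A := Matrix.detRowAlternating fun i => y (f i)

theorem exists_strictMono_maxMinor {N : ℕ} {f : Fin k → ℕ} (hf : ∀ r, f r < N) :
    maxMinor y f = 0 ∨ ∃ K ∈ columnSets k N, binWeight K = binWeight f ∧
      (maxMinor y f = maxMinor y K ∨ maxMinor y f = -maxMinor y K) := by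
  by_cases hinj : Function.Injective f
  · refine Or.inr ⟨f ∘ Tuple.sort f, ⟨(Tuple.monotone_sort f).strictMono_of_injective
      (hinj.comp (Tuple.sort f).injective), fun r => hf _⟩, ?_, ?_⟩
    · exact Equiv.sum_comp (Tuple.sort f) fun r => 2 ^ f r
    · have h : maxMinor y (f ∘ Tuple.sort f) =
          Equiv.Perm.sign (Tuple.sort f) • maxMinor y f :=
        AlternatingMap.map_perm _ (fun i => y (f i)) (Tuple.sort f)
      rcases Int.units_eq_one_or (Equiv.Perm.sign (Tuple.sort f)) with h1 | h1 <;>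
        simp [h, h1]
  · simp only [Function.Injective, not_forall] at hinj
    obtain ⟨a, b, hab, hne⟩ := hinj
    exact Or.inl (AlternatingMap.map_eq_zero_of_eq _ _ (by rw [hab]) hne)

/-- The maximal minor as a function of the columns at positions satisfying `P`, the other columns
being fixed. -/
def partialMinor (z : Fin k → Fin k → A) (P : Fin k → Prop) [DecidablePred P] :
    (Fin k → A) [⋀^{r // P r}]→ₗ[A] A where
  __ := (Matrix.detRowAlternating (n := Fin k) (R := A)).toMultilinearMap.domDomRestrict P
    fun r => z r
  map_eq_zero_of_eq' v i j hv hij :=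
    (Matrix.detRowAlternating (n := Fin k) (R := A)).map_eq_zero_of_eq _ (i := i.1) (j := j.1)
      (by simp only [dif_pos i.2, dif_pos j.2]; exact hv) fun h => hij (Subtype.ext h)

theorem partialMinor_apply (z : Fin k → Fin k → A) (P : Fin k → Prop) [DecidablePred P]
    (v : {r // P r} → Fin k → A) : partialMinor z P v =
      Matrix.detRowAlternating fun j => if h : P j then v ⟨j, h⟩ else z j := rfl

theorem alternatingMap_eq_zero_of_card_lt {ι N : Type*} [Fintype ι] [AddCommGroup N] [Module A N]
    (hι : k < Fintype.card ι) (g : (Fin k → A) [⋀^ι]→ₗ[A] N) : g = 0 := by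
  refine (Pi.basisFun A (Fin k)).ext_alternating fun v hv => ?_
  have := Fintype.card_le_of_injective v hv
  simp at this
  omega

/-- Among the `|β|`-element subsets of `α ⊕ β`, the subset `β` has the smallest weight if all
weights on `β` are smaller than those on `α`. -/
theorem sum_inr_lt_sum_perm {α β : Type*} [Fintype α] [Fintype β] [DecidableEq α] [DecidableEq β]
    (w : α ⊕ β → ℕ) (c : ℕ) (ha : ∀ a, c < w (Sum.inl a)) (hb : ∀ b, w (Sum.inr b) ≤ c)
    (σ : Equiv.Perm (α ⊕ β)) (hσ : ∃ b a, σ (Sum.inr b) = Sum.inl a) :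
    ∑ b, w (Sum.inr b) < ∑ b, w (σ (Sum.inr b)) := by
  classical
  obtain ⟨b₀, a₀, h₀⟩ := hσ
  set v : α ⊕ β → ℤ := fun x => w x - c with hv
  have hva : ∀ a, 0 < v (Sum.inl a) := fun a => by have := ha a; simp only [hv]; omega
  have hvb : ∀ b, v (Sum.inr b) ≤ 0 := fun b => by have := hb b; simp only [hv]; omega
  set S : Finset (α ⊕ β) := Finset.univ.image fun b => σ (Sum.inr b) with hS
  have hsumS : ∑ b, v (σ (Sum.inr b)) = ∑ x ∈ S, v x := by
    rw [hS, Finset.sum_image]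
    intro x _ y _ h
    exact Sum.inr_injective (σ.injective h)
  have hsplit : ∑ x ∈ S, v x = ∑ a, (if Sum.inl a ∈ S then v (Sum.inl a) else 0) +
      ∑ b, (if Sum.inr b ∈ S then v (Sum.inr b) else 0) := by
    rw [← Fintype.sum_sum_type (fun x => if x ∈ S then v x else 0), Finset.sum_ite_mem,
      Finset.univ_inter]
  have h1 : 0 < ∑ a, (if Sum.inl a ∈ S then v (Sum.inl a) else 0) := by
    refine Finset.sum_pos' (fun a _ => by split_ifs; exacts [(hva a).le, le_rfl])
      ⟨a₀, Finset.mem_univ _, ?_⟩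
    rw [if_pos (Finset.mem_image.mpr ⟨b₀, Finset.mem_univ _, h₀⟩)]
    exact hva a₀
  have h2 : ∑ b, v (Sum.inr b) ≤ ∑ b, (if Sum.inr b ∈ S then v (Sum.inr b) else 0) := by
    refine Finset.sum_le_sum fun b _ => ?_
    split_ifs
    exacts [le_rfl, hvb b]
  have h3 : ∑ b, v (Sum.inr b) < ∑ b, v (σ (Sum.inr b)) := by rw [hsumS, hsplit]; linarith
  simp only [hv, Finset.sum_sub_distrib] at h3
  have h4 := (sub_lt_sub_iff_right _).mp h3
  exact_mod_cast h4

/-- The quadratic straightening relation for a pair of maximal minors violating the tableau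
order. -/
theorem maxMinor_mul_mem_span [Algebra ℂ A] {N : ℕ} {K L : Fin k → ℕ} (hK : K ∈ columnSets k N)
    (hL : L ∈ columnSets k N) (hKL : ¬ K ≤ L) (hLK : ¬ L ≤ K) :
    maxMinor y K * maxMinor y L ∈ Submodule.span ℂ {b | ∃ U ∈ columnSets k N,
      ∃ V ∈ columnSets k N, binWeight K ^ 2 + binWeight L ^ 2 <
        binWeight U ^ 2 + binWeight V ^ 2 ∧ b = maxMinor y U * maxMinor y V} := by
  classical
  wlog hw : binWeight K ≤ binWeight L generalizing K L with H
  · have := H hL hK hLK hKL (le_of_not_ge hw)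
    rwa [mul_comm, add_comm (binWeight K ^ 2)]
  set S := Submodule.span ℂ {b | ∃ U ∈ columnSets k N,
      ∃ V ∈ columnSets k N, binWeight K ^ 2 + binWeight L ^ 2 <
        binWeight U ^ 2 + binWeight V ^ 2 ∧ b = maxMinor y U * maxMinor y V} with hS
  simp only [Pi.le_def, not_forall, not_le] at hKL
  obtain ⟨s, hs⟩ := hKL
  set u : {r // s ≤ r} ⊕ {r // r ≤ s} → ℕ := Sum.elim (fun r => K r) (fun r => L r) with hu
  set Kσ : Equiv.Perm ({r // s ≤ r} ⊕ {r // r ≤ s}) → Fin k → ℕ := fun σ j =>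
    if h : s ≤ j then u (σ (Sum.inl ⟨j, h⟩)) else K j with hKσ
  set Lσ : Equiv.Perm ({r // s ≤ r} ⊕ {r // r ≤ s}) → Fin k → ℕ := fun σ j =>
    if h : j ≤ s then u (σ (Sum.inr ⟨j, h⟩)) else L j with hLσ
  set a := partialMinor (fun j => y (K j)) (fun r => s ≤ r) with ha
  set b := partialMinor (fun j => y (L j)) (fun r => r ≤ s) with hb
  have hzero : a.domCoprod b = 0 := by
    apply alternatingMap_eq_zero_of_card_lt
    rw [Fintype.card_sum, Fintype.card_subtype, Fintype.card_subtype]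
    have h1 : (Finset.univ.filter fun r => s ≤ r) = Finset.Ici s := by ext; simp
    have h2 : (Finset.univ.filter fun r => r ≤ s) = Finset.Iic s := by ext; simp
    rw [h1, h2, Fin.card_Ici, Fin.card_Iic]
    omega
  have hterm : ∀ σ, LinearMap.mul' A A (AlternatingMap.domCoprod.summand a b
      (Quotient.mk'' σ) fun x => y (u x)) =
      Equiv.Perm.sign σ • (maxMinor y (Kσ σ) * maxMinor y (Lσ σ)) := by
    intro σ
    rw [AlternatingMap.domCoprod.summand_mk'']
    change LinearMap.mul' A A (Equiv.Perm.sign σ • ((a fun i => y (u (σ (Sum.inl i)))) ⊗ₜ[A]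
      (b fun i => y (u (σ (Sum.inr i)))))) = _
    rw [Units.smul_def, map_zsmul, LinearMap.mul'_apply, ← Units.smul_def, ha, hb,
      partialMinor_apply, partialMinor_apply]
    unfold maxMinor
    congr 3
    · funext j
      simp only [hKσ]
      split_ifs <;> rfl
    · funext j
      simp only [hLσ]
      split_ifs <;> rfl
  have hK1 : Kσ 1 = K := by
    ext j; simp only [hKσ, hu]; split_ifs <;> simp
  have hL1 : Lσ 1 = L := by
    ext j; simp only [hLσ, hu]; split_ifs <;> simp
  have hbig : ∀ σ : Equiv.Perm ({r // s ≤ r} ⊕ {r // r ≤ s}),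
      (∃ b a, σ (Sum.inr b) = Sum.inl a) → maxMinor y (Kσ σ) * maxMinor y (Lσ σ) ∈ S := by
    intro σ hσ
    have hsum : ∀ (P : Fin k → Prop) [DecidablePred P] (g : {r // P r} → ℕ) (z : Fin k → ℕ),
        binWeight (fun j => if h : P j then g ⟨j, h⟩ else z j) =
          ∑ r, 2 ^ g r + ∑ r ∈ Finset.univ.filter fun r => ¬ P r, 2 ^ z r := by
      intro P _ g z
      unfold binWeight
      rw [← Finset.sum_filter_add_sum_filter_not Finset.univ P]
      congr 1
      · rw [← Finset.sum_subtype_eq_sum_filter]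
        simp only [Finset.subtype_univ]
        refine Finset.sum_congr rfl fun r _ => ?_
        simp only [dif_pos r.2]
      · refine Finset.sum_congr rfl fun r hr => ?_
        simp only [dif_neg (Finset.mem_filter.mp hr).2]
    have eK : ∀ σ, binWeight (Kσ σ) = ∑ r, 2 ^ u (σ (Sum.inl r)) + _ := fun σ =>
      hsum (fun r => s ≤ r) (fun r => u (σ (Sum.inl r))) K
    have eL : ∀ σ, binWeight (Lσ σ) = ∑ r, 2 ^ u (σ (Sum.inr r)) + _ := fun σ =>
      hsum (fun r => r ≤ s) (fun r => u (σ (Sum.inr r))) L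
    have eK1 := eK 1
    have eL1 := eL 1
    rw [hK1] at eK1
    rw [hL1] at eL1
    have eKσ := eK σ
    have eLσ := eL σ
    simp only [Equiv.Perm.one_apply] at eK1 eL1
    have htot := Equiv.sum_comp σ fun x => 2 ^ u x
    rw [Fintype.sum_sum_type, Fintype.sum_sum_type] at htot
    have hlt := sum_inr_lt_sum_perm (fun x => 2 ^ u x) (2 ^ L s)
      (fun r => Nat.pow_lt_pow_right one_lt_two (hs.trans_le (hK.1.monotone r.2)))
      (fun r => Nat.pow_le_pow_right two_pos (hL.1.monotone r.2)) σ hσ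
    have h1 : binWeight (Kσ σ) + binWeight (Lσ σ) = binWeight K + binWeight L := by omega
    have h2 : binWeight L < binWeight (Lσ σ) := by omega
    have hsq : binWeight K ^ 2 + binWeight L ^ 2 <
        binWeight (Kσ σ) ^ 2 + binWeight (Lσ σ) ^ 2 := by
      zify at h1 h2 hw ⊢
      nlinarith
    have hu' : ∀ x, u x < N := by
      rintro (x | x)
      exacts [hK.2 _, hL.2 _]
    have hKN : ∀ r, Kσ σ r < N := by
      intro r; simp only [hKσ]; split_ifs
      exacts [hu' _, hK.2 _]
    have hLN : ∀ r, Lσ σ r < N := by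
      intro r; simp only [hLσ]; split_ifs
      exacts [hu' _, hL.2 _]
    rcases exists_strictMono_maxMinor y hKN with h0 | ⟨U, hU, hUw, hU'⟩
    · rw [h0, zero_mul]; exact zero_mem _
    rcases exists_strictMono_maxMinor y hLN with h0 | ⟨V, hV, hVw, hV'⟩
    · rw [h0, mul_zero]; exact zero_mem _
    have hmem : maxMinor y U * maxMinor y V ∈ S :=
      Submodule.subset_span ⟨U, hU, V, hV, by rw [hUw, hVw]; exact hsq, rfl⟩
    rcases hU' with h | h <;> rcases hV' with h' | h' <;> rw [h, h'] <;>
      simpa using hmem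
  have hsum := congrArg (LinearMap.mul' A A)
    (DFunLike.congr_fun hzero fun x => y (u x))
  rw [AlternatingMap.domCoprod_apply, sum_apply, map_sum,
    AlternatingMap.zero_apply, map_zero] at hsum
  replace hsum := (Finset.add_sum_erase _ _ (@Finset.mem_univ _ (_)
    (Quotient.mk'' 1 : Equiv.Perm.ModSumCongr {r // s ≤ r} {r // r ≤ s}))).trans hsum
  rw [hterm] at hsum
  rw [hK1, hL1, Equiv.Perm.sign_one, one_smul] at hsum
  rw [eq_neg_of_add_eq_zero_left hsum]
  refine neg_mem (sum_mem fun q hq => ?_)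
  induction q using Quotient.inductionOn' with
  | _ σ =>
    rw [hterm]
    have hmem : maxMinor y (Kσ σ) * maxMinor y (Lσ σ) ∈ S := by
      apply hbig
      by_contra! hno
      apply (Finset.mem_erase.mp hq).1
      symm
      refine Quotient.sound' ?_
      rw [QuotientGroup.leftRel_apply, inv_one, one_mul]
      refine Equiv.Perm.mem_sumCongrHom_range_of_perm_mapsTo_inl
        ((Equiv.Perm.perm_mapsTo_inl_iff_mapsTo_inr σ).mpr ?_)
      rintro _ ⟨x, rfl⟩
      rcases h : σ (Sum.inr x) with z | z
      · exact absurd h (hno x z)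
      · exact ⟨z, rfl⟩
    rcases Int.units_eq_one_or (Equiv.Perm.sign σ) with h | h <;> rw [h] <;>
      simpa [Units.smul_def] using hmem

end Minors

section Anticommuting

variable {E : Type*} [Ring E] {Y : ℕ → E}

theorem prod_map_perm_of_anticomm (hanti : ∀ c d, Y c * Y d = -(Y d * Y c)) {l l' : List ℕ}
    (h : l.Perm l') :
    (l.map Y).prod = (l'.map Y).prod ∨ (l.map Y).prod = -(l'.map Y).prod := by
  induction h with
  | nil => exact Or.inl rfl
  | cons x _ ih =>
    simp only [List.map_cons, List.prod_cons]
    rcases ih with h | h <;> rw [h]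
    · exact Or.inl rfl
    · exact Or.inr (mul_neg _ _)
  | swap x z l =>
    right
    simp only [List.map_cons, List.prod_cons]
    rw [← mul_assoc, hanti, neg_mul, mul_assoc]
  | trans _ _ ih₁ ih₂ =>
    rcases ih₁ with h | h <;> rcases ih₂ with h' | h' <;> rw [h, h'] <;> simp

theorem mul_prod_map_eq_zero_of_mem (hsq : ∀ c, Y c * Y c = 0)
    (hanti : ∀ c d, Y c * Y d = -(Y d * Y c)) {c : ℕ} {l : List ℕ} (h : c ∈ l) :
    Y c * (l.map Y).prod = 0 := by
  induction l with
  | nil => simp at h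
  | cons d l ih =>
    rw [List.map_cons, List.prod_cons, ← mul_assoc]
    rcases List.mem_cons.mp h with rfl | h
    · rw [hsq, zero_mul]
    · rw [hanti, neg_mul, mul_assoc, ih h, mul_zero, neg_zero]

/-- The quadratic element attached to the `u`-th symplectic pair of columns. -/
def pairElt (Y : ℕ → E) (u : ℕ) : E := Y (2 * u) * Y (2 * u + 1)

theorem pairElt_commute (hanti : ∀ c d, Y c * Y d = -(Y d * Y c)) (u v : ℕ) :
    Commute (pairElt Y u) (pairElt Y v) := by
  have h : ∀ c, Commute (pairElt Y u) (Y c) := by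
    intro c
    unfold pairElt Commute SemiconjBy
    rw [mul_assoc, hanti (2 * u + 1) c, mul_neg, ← mul_assoc, hanti (2 * u) c, neg_mul, neg_neg,
      mul_assoc]
  exact (h _).mul_right (h _)

theorem pairElt_mul_eq_zero (hsq : ∀ c, Y c * Y c = 0)
    (hanti : ∀ c d, Y c * Y d = -(Y d * Y c)) {u : ℕ} {l : List ℕ}
    (h : 2 * u ∈ l ∨ 2 * u + 1 ∈ l) : pairElt Y u * (l.map Y).prod = 0 := by
  unfold pairElt
  rcases h with h | h
  · rw [hanti, neg_mul, mul_assoc, mul_prod_map_eq_zero_of_mem hsq hanti h, mul_zero, neg_zero]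
  · rw [mul_assoc, mul_prod_map_eq_zero_of_mem hsq hanti h, mul_zero]

theorem pairElt_sq (hsq : ∀ c, Y c * Y c = 0) (hanti : ∀ c d, Y c * Y d = -(Y d * Y c))
    (u : ℕ) : pairElt Y u * pairElt Y u = 0 := by
  simpa [pairElt] using pairElt_mul_eq_zero hsq hanti (u := u) (l := [2 * u, 2 * u + 1])
    (by simp)

theorem prod_map_pairElt (l : List ℕ) :
    (l.map (pairElt Y)).prod = ((l.flatMap fun u => [2 * u, 2 * u + 1]).map Y).prod := by
  induction l with
  | nil => simp
  | cons u l ih => simp [ih, pairElt, mul_assoc]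

theorem Commute.add_pow_of_sq_eq_zero {x s : E} (h : Commute x s) (hx : x * x = 0) (m : ℕ) :
    (x + s) ^ (m + 1) = s ^ (m + 1) + (m + 1) • (x * s ^ m) := by
  induction m with
  | zero => simp [add_comm]
  | succ m ih =>
    have h1 : s ^ (m + 1) * x = x * s ^ (m + 1) := (h.pow_right _).symm.eq
    have h2 : x * s ^ m * x = 0 := by
      rw [mul_assoc, (h.pow_right m).symm.eq, ← mul_assoc, hx, zero_mul]
    have h3 : x * s ^ m * s = x * s ^ (m + 1) := by rw [mul_assoc, ← pow_succ]
    rw [pow_succ, ih, add_mul, mul_add, mul_add, smul_mul_assoc, smul_mul_assoc, h1, h2, h3,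
      ← pow_succ, smul_zero, zero_add, succ_nsmul _ (m + 1)]
    abel

theorem sum_pow_of_sq_eq_zero {e : ℕ → E} (hcomm : ∀ u v, Commute (e u) (e v))
    (hsq : ∀ u, e u * e u = 0) (l : List ℕ) :
    (l.map e).sum ^ l.length = l.length.factorial • (l.map e).prod ∧
      ∀ m, l.length < m → (l.map e).sum ^ m = 0 := by
  induction l with
  | nil => exact ⟨by simp, fun m hm => by
      rw [List.map_nil, List.sum_nil, zero_pow (Nat.ne_of_gt (Nat.zero_lt_of_lt hm))]⟩
  | cons x l ih =>
    have hx : Commute (e x) (l.map e).sum :=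
      Commute.list_sum_right _ _ fun y hy => by
        obtain ⟨v, _, rfl⟩ := List.mem_map.mp hy
        exact hcomm x v
    simp only [List.map_cons, List.sum_cons, List.prod_cons, List.length_cons]
    constructor
    · rw [hx.add_pow_of_sq_eq_zero (hsq x), ih.1, ih.2 _ (Nat.lt_succ_self _), zero_add,
        mul_smul_comm, smul_smul, Nat.factorial_succ]
    · intro m hm
      obtain ⟨m, rfl⟩ := Nat.exists_eq_succ_of_ne_zero (by omega : m ≠ 0)
      rw [Nat.succ_eq_add_one, hx.add_pow_of_sq_eq_zero (hsq x), ih.2 _ (by omega),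
        ih.2 _ (by omega), mul_zero, smul_zero, add_zero]

/-- If the pair elements sum to zero, a product of anticommuting elements containing many full pairs
among the first `p` pairs can be rewritten by products containing a pair beyond the first `p`. -/
theorem factorial_smul_prod_mem (hsq : ∀ c, Y c * Y c = 0)
    (hanti : ∀ c d, Y c * Y d = -(Y d * Y c)) {n p : ℕ} (hp : p ≤ n)
    (hsum : ∑ u ∈ Finset.range n, pairElt Y u = 0) {S D : Finset ℕ} {rest : List ℕ}
    (hS : S ⊆ Finset.range p) (hD : D ⊆ Finset.range p) (hSD : Disjoint S D)
    (hrest : ∀ u ∈ Finset.range p, u ∉ S → u ∉ D → 2 * u ∈ rest ∨ 2 * u + 1 ∈ rest)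
    (hcard : D.card < S.card) (T : AddSubgroup E)
    (hT : ∀ l : List ℕ, (∀ u ∈ l, u < p) → l.length + 1 = S.card → ∀ v, p ≤ v → v < n →
      ((((l ++ [v]).flatMap fun u => [2 * u, 2 * u + 1]) ++ rest).map Y).prod ∈ T) :
    S.card.factorial • (((S.toList.flatMap fun u => [2 * u, 2 * u + 1]) ++ rest).map Y).prod
      ∈ T := by
  set e := pairElt Y with he
  set R := (rest.map Y).prod with hR
  set s := ∑ u ∈ S, e u with hs
  set t := ∑ u ∈ D, e u with ht
  have hcomm : ∀ u v, Commute (e u) (e v) := pairElt_commute hanti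
  have hst : Commute s (-t) := (Commute.sum_left _ _ _ fun u _ =>
    Commute.sum_right _ _ _ fun v _ => hcomm u v).neg_right
  have hspow : s ^ S.card = S.card.factorial • (S.toList.map e).prod := by
    have := (sum_pow_of_sq_eq_zero hcomm (pairElt_sq hsq hanti) S.toList).1
    rwa [Finset.sum_map_toList, Finset.length_toList] at this
  have htpow : (-t) ^ S.card = 0 := by
    have := (sum_pow_of_sq_eq_zero hcomm (pairElt_sq hsq hanti) D.toList).2 S.card
      (by rwa [Finset.length_toList])
    rw [Finset.sum_map_toList] at this
    rw [neg_pow, this, mul_zero]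
  have hstR : (s - -t) * R = -∑ v ∈ Finset.Ico p n, e v * R := by
    have h1 : (∑ u ∈ Finset.range p, e u) * R = (s + t) * R := by
      rw [hs, ht, ← Finset.sum_union hSD, Finset.sum_mul, Finset.sum_mul]
      symm
      apply Finset.sum_subset (Finset.union_subset hS hD)
      intro u hu hu'
      rw [Finset.mem_union, not_or] at hu'
      exact pairElt_mul_eq_zero hsq hanti (hrest u hu hu'.1 hu'.2)
    have h2 := Finset.sum_range_add_sum_Ico e hp
    rw [hsum] at h2
    rw [sub_neg_eq_add, ← h1, ← Finset.sum_mul, eq_neg_of_add_eq_zero_left h2, neg_mul]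
  have hexp : ∀ (m : ℕ) (A : Finset ℕ) (X : E), A ⊆ Finset.range p →
      (∀ l : List ℕ, (∀ u ∈ l, u < p) → l.length = m + 1 → (l.map e).prod * X ∈ T) →
      ∀ l : List ℕ, (∀ u ∈ l, u < p) → l.length = m →
        (l.map e).prod * ((∑ u ∈ A, e u) * X) ∈ T := by
    intro m A X hA h l hl hlm
    rw [← mul_assoc, Finset.mul_sum, Finset.sum_mul]
    refine sum_mem fun u hu => ?_
    have := h (l ++ [u]) (by
      intro v hv
      rcases List.mem_append.mp hv with hv | hv
      · exact hl v hv
      · rw [List.mem_singleton.mp hv]; exact Finset.mem_range.mp (hA hu)) (by simp [hlm])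
    simpa using this
  have hpow : ∀ (i m : ℕ) (A : Finset ℕ) (X : E), A ⊆ Finset.range p →
      (∀ l : List ℕ, (∀ u ∈ l, u < p) → l.length = m + i → (l.map e).prod * X ∈ T) →
      ∀ l : List ℕ, (∀ u ∈ l, u < p) → l.length = m →
        (l.map e).prod * ((∑ u ∈ A, e u) ^ i * X) ∈ T := by
    intro i
    induction i with
    | zero => intro m A X _ h l hl hlm; simpa using h l hl (by simpa using hlm)
    | succ i ih =>
      intro m A X hA h l hl hlm
      rw [pow_succ', mul_assoc]
      refine hexp m A _ hA (ih (m + 1) A X hA fun l hl hlm => h l hl (by omega)) l hl hlm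
  have hmain : s ^ S.card * R ∈ T := by
    have h1 := hst.geom_sum₂_mul S.card
    rw [htpow, sub_zero] at h1
    rw [← h1, mul_assoc, hstR, mul_neg, Finset.mul_sum]
    refine neg_mem (sum_mem fun v hv => ?_)
    rw [Finset.sum_mul]
    refine sum_mem fun i hi => ?_
    rw [Finset.mem_Ico] at hv
    rw [Finset.mem_range] at hi
    have h2 : s ^ i * t ^ (S.card - 1 - i) * (e v * R) ∈ T := by
      have := hpow i 0 S (t ^ (S.card - 1 - i) * (e v * R)) hS
        (fun l hl hlm => hpow (S.card - 1 - i) i D _ hD (fun l hl hlm => ?_) l hl (by omega)) []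
        (by simp) rfl
      · simpa [mul_assoc] using this
      · have := hT l hl (by omega) v hv.1 hv.2
        rw [List.map_append, List.prod_append, ← prod_map_pairElt] at this
        simpa [mul_assoc] using this
    rw [neg_pow]
    rcases neg_one_pow_eq_or E (S.card - 1 - i) with h | h <;> rw [h]
    · simpa using h2
    · simpa using neg_mem h2
  rw [List.map_append, List.prod_append, ← prod_map_pairElt, ← smul_mul_assoc, ← he, ← hspow]
  exact hmain

end Anticommuting

section Straightening

variable {k : ℕ} {A : Type*} [CommRing A]

theorem List.exists_eq_ofFn {α : Type*} {l : List α} (h : l.length = k) :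
    ∃ f : Fin k → α, l = List.ofFn f := by
  subst h
  exact ⟨l.get, (List.ofFn_get l).symm⟩

/-- The determinant as a linear form on the exterior algebra. -/
def detForm (k : ℕ) (A : Type*) [CommRing A] : ExteriorAlgebra A (Fin k → A) →ₗ[A] A :=
  ExteriorAlgebra.liftAlternating
    (Pi.single (M := fun i => (Fin k → A) [⋀^Fin i]→ₗ[A] A) k Matrix.detRowAlternating)

theorem detForm_prod_ofFn (y : ℕ → Fin k → A) (f : Fin k → ℕ) :
    detForm k A (((List.ofFn f).map fun c => ExteriorAlgebra.ι A (y c)).prod) = maxMinor y f := by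
  have h : ((List.ofFn f).map fun c => ExteriorAlgebra.ι A (y c)).prod =
      ExteriorAlgebra.ιMulti A k fun i => y (f i) := by
    rw [ExteriorAlgebra.ιMulti_apply, List.map_ofFn]
    rfl
  rw [h, detForm, ExteriorAlgebra.liftAlternating_apply_ιMulti, Pi.single_eq_same]
  rfl

theorem ι_mul_ι_eq_neg (v w : Fin k → A) : ExteriorAlgebra.ι A v * ExteriorAlgebra.ι A w =
    -(ExteriorAlgebra.ι A w * ExteriorAlgebra.ι A v) :=
  eq_neg_of_add_eq_zero_left (ExteriorAlgebra.ι_add_mul_swap v w)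

theorem eq_zero_of_eq_neg_of_algebra [Algebra ℂ A] {M : Type*} [AddCommGroup M] [Module A M]
    {x : M} (h : x = -x) : x = 0 := by
  have h2 : (2 : A) • x = 0 := by rw [two_smul]; nth_rewrite 1 [h]; exact neg_add_cancel x
  have h3 : algebraMap ℂ A (1 / 2) * 2 = 1 := by
    rw [← map_ofNat (algebraMap ℂ A) 2, ← map_mul]
    norm_num
  rw [← one_smul A x, ← h3, mul_smul, h2, smul_zero]

theorem sum_pairElt_ι_eq_zero [Algebra ℂ A] (y : ℕ → Fin k → A) {n : ℕ}
    (hy : ∀ i j, ∑ u ∈ Finset.range n,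
      (y (2 * u) i * y (2 * u + 1) j - y (2 * u) j * y (2 * u + 1) i) = 0) :
    ∑ u ∈ Finset.range n, pairElt (fun c => ExteriorAlgebra.ι A (y c)) u = 0 := by
  set e : Fin k → ExteriorAlgebra A (Fin k → A) :=
    fun i => ExteriorAlgebra.ι A (Pi.single i (1 : A)) with he
  set C : Fin k → Fin k → A := fun i j => ∑ u ∈ Finset.range n, y (2 * u) i * y (2 * u + 1) j
    with hC
  have hsymm : ∀ i j, C i j = C j i := by
    intro i j
    have := hy i j
    rwa [Finset.sum_sub_distrib, sub_eq_zero] at this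
  have hexp : ∀ v : Fin k → A, ExteriorAlgebra.ι A v = ∑ i, v i • e i := by
    intro v
    conv_lhs => rw [pi_eq_sum_univ' v]
    simp only [map_sum, map_smul, he]
  have hX : ∑ u ∈ Finset.range n, pairElt (fun c => ExteriorAlgebra.ι A (y c)) u =
      ∑ i, ∑ j, C i j • (e i * e j) := by
    simp only [pairElt, hC, Finset.sum_smul]
    rw [Finset.sum_congr rfl fun i _ => Finset.sum_comm, Finset.sum_comm]
    refine Finset.sum_congr rfl fun u _ => ?_
    rw [hexp, hexp, Finset.sum_mul_sum]
    simp only [smul_mul_smul_comm]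
  rw [hX]
  apply eq_zero_of_eq_neg_of_algebra (A := A)
  conv_lhs => rw [Finset.sum_comm]
  rw [← Finset.sum_neg_distrib]
  refine Finset.sum_congr rfl fun i _ => ?_
  rw [← Finset.sum_neg_distrib]
  refine Finset.sum_congr rfl fun j _ => ?_
  rw [hsymm, ι_mul_ι_eq_neg, smul_neg]

theorem sum_three_mul_four_pow_lt (p : ℕ) : ∑ u ∈ Finset.range p, 3 * 4 ^ u < 4 ^ p := by
  induction p with
  | zero => simp
  | succ p ih => rw [Finset.sum_range_succ, pow_succ]; omega

theorem sum_map_flatMap_pair (l : List ℕ) :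
    ((l.flatMap fun u => [2 * u, 2 * u + 1]).map (2 ^ ·)).sum = (l.map fun u => 3 * 4 ^ u).sum := by
  induction l with
  | nil => simp
  | cons u l ih =>
    simp only [List.flatMap_cons, List.map_append, List.sum_append, ih, List.map_cons, List.sum_cons,
      List.map_nil, List.sum_nil, pow_succ, pow_mul]
    norm_num
    ring

theorem length_flatMap_pair (l : List ℕ) :
    (l.flatMap fun u => [2 * u, 2 * u + 1]).length = 2 * l.length := by
  induction l with
  | nil => simp
  | cons u l ih => simp only [List.flatMap_cons, List.length_append, ih, List.length_cons,
      List.length_nil]; ring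

/-- The indices `u < p` such that both `2u` and `2u+1` lie in `s`. -/
def fullPairs (s : Finset ℕ) (p : ℕ) : Finset ℕ :=
  {u ∈ Finset.range p | 2 * u ∈ s ∧ 2 * u + 1 ∈ s}

/-- The indices `u < p` such that neither `2u` nor `2u+1` lies in `s`. -/
def emptyPairs (s : Finset ℕ) (p : ℕ) : Finset ℕ :=
  {u ∈ Finset.range p | 2 * u ∉ s ∧ 2 * u + 1 ∉ s}

/-- The elements of `s` outside its full pairs. -/
def restPairs (s : Finset ℕ) (p : ℕ) : Finset ℕ := {c ∈ s | c / 2 ∉ fullPairs s p}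

theorem card_add_card_emptyPairs_le (s : Finset ℕ) (p : ℕ) :
    ({c ∈ s | c < 2 * p} : Finset ℕ).card + (emptyPairs s p).card ≤
      p + (fullPairs s p).card := by
  have h1 : ({c ∈ s | c < 2 * p} : Finset ℕ).card = ∑ u ∈ Finset.range p,
      ({c ∈ ({c ∈ s | c < 2 * p} : Finset ℕ) | c / 2 = u} : Finset ℕ).card :=
    Finset.card_eq_sum_card_fiberwise fun c hc => by
      simp only [Finset.coe_filter, Set.mem_ofPred_eq] at hc
      simp only [Finset.coe_range, Set.mem_Iio]
      omega
  rw [h1, emptyPairs, fullPairs, Finset.card_filter, Finset.card_filter, ← Finset.sum_add_distrib]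
  have h3 : p = ∑ u ∈ Finset.range p, 1 := by simp
  nth_rewrite 4 [h3]
  rw [← Finset.sum_add_distrib]
  refine Finset.sum_le_sum fun u _ => ?_
  have h2 : ({c ∈ ({c ∈ s | c < 2 * p} : Finset ℕ) | c / 2 = u} : Finset ℕ) ⊆
      {c ∈ ({2 * u, 2 * u + 1} : Finset ℕ) | c ∈ s} := by
    intro c hc
    simp only [Finset.mem_filter, Finset.mem_insert, Finset.mem_singleton] at hc ⊢
    refine ⟨by omega, hc.1.1⟩
  refine (Nat.add_le_add_right (Finset.card_le_card h2) _).trans ?_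
  by_cases ha : 2 * u ∈ s <;> by_cases hb : 2 * u + 1 ∈ s <;>
    simp [ha, hb, Finset.filter_insert, Finset.filter_singleton]

theorem perm_fullPairs_append_restPairs (s : Finset ℕ) (p : ℕ) {l : List ℕ} (hl : l.Nodup)
    (hs : ∀ c, c ∈ l ↔ c ∈ s) : l.Perm (((fullPairs s p).toList.flatMap
      fun u => [2 * u, 2 * u + 1]) ++ (restPairs s p).toList) := by
  have key : ∀ c, (∃ u ∈ fullPairs s p, c = 2 * u ∨ c = 2 * u + 1) ↔ c / 2 ∈ fullPairs s p := by
    intro c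
    constructor
    · rintro ⟨u, hu, h⟩
      rwa [show c / 2 = u by omega]
    · exact fun h => ⟨c / 2, h, by omega⟩
  rw [List.perm_ext_iff_of_nodup hl]
  · intro c
    simp only [hs, List.mem_append, List.mem_flatMap, Finset.mem_toList, List.mem_cons,
      List.not_mem_nil, or_false, key, restPairs, Finset.mem_filter]
    constructor
    · intro h; by_cases h' : c / 2 ∈ fullPairs s p <;> simp [h, h']
    · rintro (h | h)
      · simp only [fullPairs, Finset.mem_filter] at h
        rcases Nat.even_or_odd' c with ⟨v, rfl | rfl⟩
        · rw [show 2 * v / 2 = v by omega] at h; exact h.2.1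
        · rw [show (2 * v + 1) / 2 = v by omega] at h; exact h.2.2
      · exact h.1
  · rw [List.nodup_append']
    refine ⟨List.nodup_flatMap.mpr ⟨fun u _ => by simp, ?_⟩, Finset.nodup_toList _, ?_⟩
    · refine (Finset.nodup_toList _).imp fun {u v} huv => ?_
      simp only [Function.onFun, List.disjoint_left, List.mem_cons, List.not_mem_nil, or_false]
      omega
    · rw [List.disjoint_left]
      intro c hc
      simp only [List.mem_flatMap, Finset.mem_toList, List.mem_cons,
        List.not_mem_nil, or_false, key] at hc
      simp [restPairs, hc]

/-- A maximal minor with too many columns among the first `p` symplectic pairs is a combination of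
larger ones, modulo the isotropy relations. -/
theorem maxMinor_mem_span_of_card_lt [Algebra ℂ A] (y : ℕ → Fin k → A) {n p N : ℕ}
    (hN : 2 * n ≤ N) (hp : p ≤ n)
    (hy : ∀ i j, ∑ u ∈ Finset.range n,
      (y (2 * u) i * y (2 * u + 1) j - y (2 * u) j * y (2 * u + 1) i) = 0)
    {K : Fin k → ℕ} (hK : K ∈ columnSets k N)
    (hcard : p < ({r | K r < 2 * p} : Finset (Fin k)).card) :
    maxMinor y K ∈ Submodule.span ℂ
      {b | ∃ U ∈ columnSets k N, binWeight K < binWeight U ∧ b = maxMinor y U} := by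
  set W := Submodule.span ℂ
      {b | ∃ U ∈ columnSets k N, binWeight K < binWeight U ∧ b = maxMinor y U}
  set Y : ℕ → ExteriorAlgebra A (Fin k → A) := fun c => ExteriorAlgebra.ι A (y c) with hY
  set s : Finset ℕ := Finset.univ.image K
  have hmem : ∀ c, c ∈ List.ofFn K ↔ c ∈ s := by
    intro c; simp [s, List.mem_ofFn]
  have hperm := perm_fullPairs_append_restPairs s p (List.nodup_ofFn.mpr hK.1.injective) hmem
  have hanti : ∀ c d, Y c * Y d = -(Y d * Y c) := fun c d => ι_mul_ι_eq_neg _ _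
  have hcard' : (emptyPairs s p).card < (fullPairs s p).card := by
    have h1 := card_add_card_emptyPairs_le s p
    have h2 : ({c ∈ s | c < 2 * p} : Finset ℕ) =
        ({r | K r < 2 * p} : Finset (Fin k)).image K := by
      ext c
      simp only [s, Finset.mem_filter, Finset.mem_image, Finset.mem_univ, true_and]
      constructor
      · rintro ⟨⟨r, rfl⟩, h⟩; exact ⟨r, h, rfl⟩
      · rintro ⟨r, h, rfl⟩; exact ⟨⟨r, rfl⟩, h⟩
    rw [h2, Finset.card_image_of_injective _ hK.1.injective] at h1
    omega
  have hlen := hperm.length_eq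
  rw [List.length_ofFn, List.length_append, length_flatMap_pair, Finset.length_toList] at hlen
  have hwt : binWeight K = ((fullPairs s p).toList.map fun u => 3 * 4 ^ u).sum +
      ((restPairs s p).toList.map (2 ^ ·)).sum := by
    have := (hperm.map (2 ^ ·)).sum_eq
    rw [List.map_append, List.sum_append, sum_map_flatMap_pair] at this
    rw [← this, List.map_ofFn, List.sum_ofFn]
    rfl
  have hfac := factorial_smul_prod_mem (Y := Y) (S := fullPairs s p) (D := emptyPairs s p)
    (rest := (restPairs s p).toList) (fun c => ExteriorAlgebra.ι_sq_zero _)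
    hanti hp (sum_pairElt_ι_eq_zero y hy) (Finset.filter_subset _ _) (Finset.filter_subset _ _)
    (Finset.disjoint_left.mpr fun u hu hu' =>
      (Finset.mem_filter.mp hu').2.1 (Finset.mem_filter.mp hu).2.1)
    (fun u hu h1 h2 => by
      simp only [restPairs, Finset.mem_toList, Finset.mem_filter,
        show 2 * u / 2 = u by omega, show (2 * u + 1) / 2 = u by omega]
      simp only [emptyPairs, fullPairs, Finset.mem_filter, hu, true_and] at h1 h2 ⊢
      tauto) hcard' (AddSubgroup.comap (detForm k A).toAddMonoidHom W.toAddSubgroup)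
    (fun l hl hlS v hpv hvn => by
      obtain ⟨f, hf⟩ := List.exists_eq_ofFn (k := k)
        (l := ((l ++ [v]).flatMap fun u => [2 * u, 2 * u + 1]) ++ (restPairs s p).toList) (by
          rw [List.length_append, length_flatMap_pair, List.length_append,
            List.length_singleton, hlS]
          exact hlen.symm)
      rw [AddSubgroup.mem_comap, hf]
      change detForm k A _ ∈ W
      rw [detForm_prod_ofFn]
      have hfN : ∀ r, f r < N := by
        intro r
        have : f r ∈ List.ofFn f := List.mem_ofFn.mpr ⟨r, rfl⟩
        rw [← hf] at this
        simp only [List.mem_append, List.mem_flatMap, List.mem_cons, List.not_mem_nil, or_false,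
          Finset.mem_toList, restPairs, Finset.mem_filter] at this
        rcases this with ⟨u, hu, h⟩ | h
        · have : u < n := by
            rcases hu with hu | rfl
            · exact (hl u hu).trans_le hp
            · exact hvn
          omega
        · obtain ⟨r', _, h'⟩ := Finset.mem_image.mp h.1
          rw [← h']
          exact hK.2 r'
      rcases exists_strictMono_maxMinor y hfN with h | ⟨U, hU, hUf, h⟩
      · rw [h]; exact zero_mem W
      · have hmemW : maxMinor y U ∈ W := by
          refine Submodule.subset_span ⟨U, hU, ?_, rfl⟩
          have hfw : binWeight f = (((l ++ [v]).flatMap fun u => [2 * u, 2 * u + 1]).map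
              (2 ^ ·)).sum + ((restPairs s p).toList.map (2 ^ ·)).sum := by
            rw [← List.sum_append, ← List.map_append, hf, List.map_ofFn, List.sum_ofFn]
            rfl
          rw [hUf, hwt, hfw, sum_map_flatMap_pair, Finset.sum_map_toList, List.map_append,
            List.sum_append]
          have h1 : ∑ u ∈ fullPairs s p, 3 * 4 ^ u < 4 ^ p :=
            (Finset.sum_le_sum_of_subset (Finset.filter_subset _ _)).trans_lt
              (sum_three_mul_four_pow_lt p)
          have h2 : 4 ^ p ≤ 4 ^ v := Nat.pow_le_pow_right (by norm_num) hpv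
          simp only [List.map_cons, List.map_nil, List.sum_cons, List.sum_nil]
          omega
        rcases h with h | h <;> rw [h]
        · exact hmemW
        · exact neg_mem hmemW)
  rw [AddSubgroup.mem_comap] at hfac
  change detForm k A _ ∈ W at hfac
  rw [map_nsmul] at hfac
  have hfac' : detForm k A ((((fullPairs s p).toList.flatMap fun u => [2 * u, 2 * u + 1]) ++
      (restPairs s p).toList).map Y).prod ∈ W := by
    have h0 : ((fullPairs s p).card.factorial : ℂ) ≠ 0 := by
      exact_mod_cast Nat.factorial_ne_zero _
    rw [← Nat.cast_smul_eq_nsmul ℂ] at hfac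
    exact (Submodule.smul_mem_iff _ h0).mp hfac
  rw [← detForm_prod_ofFn]
  rcases prod_map_perm_of_anticomm hanti hperm with h | h
  · change detForm k A ((List.ofFn K).map Y).prod ∈ W
    rw [h]; exact hfac'
  · change detForm k A ((List.ofFn K).map Y).prod ∈ W
    rw [h, map_neg]; exact neg_mem hfac'

end Straightening

section ChainSpanning

variable {k : ℕ} {A : Type*} [CommRing A] [Algebra ℂ A]

/-- Column tuples whose entries below `2n` dominate `0, 2, …, 2n-2`. -/
def isotropicSets (k n : ℕ) : Set (Fin k → ℕ) := {K | ∀ r, K r < 2 * n → r.1 < n ∧ 2 * r.1 ≤ K r}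

theorem exists_card_lt_of_notMem_isotropicSets {n N : ℕ} {K : Fin k → ℕ} (hK : K ∈ columnSets k N)
    (h : K ∉ isotropicSets k n) :
    ∃ p ≤ n, p < ({r | K r < 2 * p} : Finset (Fin k)).card := by
  simp only [isotropicSets, Set.mem_ofPred_eq, not_forall] at h
  obtain ⟨r, hr, h⟩ := h
  refine ⟨min r.1 n, min_le_right _ _, ?_⟩
  have hsub : Finset.Iic r ⊆ ({s | K s < 2 * min r.1 n} : Finset (Fin k)) := by
    intro s hs
    have h1 : K s ≤ K r := hK.1.monotone (Finset.mem_Iic.mp hs)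
    rw [Finset.mem_filter]
    refine ⟨Finset.mem_univ _, ?_⟩
    omega
  have := Finset.card_le_card hsub
  rw [Fin.card_Iic] at this
  omega

theorem mem_span_prod_of_mem_adjoin {X : Type*} (d : X → A) (E : Set X) {a : A}
    (ha : a ∈ Algebra.adjoin ℂ (d '' E)) :
    a ∈ Submodule.span ℂ {b | ∃ s : Multiset X, (∀ x ∈ s, x ∈ E) ∧ b = (s.map d).prod} := by
  rw [← Subalgebra.mem_toSubmodule, Algebra.adjoin_eq_span] at ha
  refine Submodule.span_mono ?_ ha
  intro b hb
  induction hb using Submonoid.closure_induction with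
  | mem x hx =>
    obtain ⟨u, hu, rfl⟩ := hx
    exact ⟨{u}, by simpa using hu, by simp⟩
  | one => exact ⟨0, by simp, by simp⟩
  | mul x y _ _ hx hy =>
    obtain ⟨s, hs, rfl⟩ := hx
    obtain ⟨t, ht, rfl⟩ := hy
    exact ⟨s + t, fun x hx => (Multiset.mem_add.mp hx).elim (hs x) (ht x), by simp⟩

theorem maxMinor_update_eq {A : Type*} [CommRing A] {y : ℕ → Fin k → A} {m : ℕ}
    (hid : ∀ s i : Fin k, y (m + s) i = if i = s then 1 else 0) (c : ℕ) (i : Fin k) :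
    maxMinor y (Function.update (fun s : Fin k => m + s.1) i c) = y c i := by
  have h : (fun s => y (Function.update (fun s : Fin k => m + s.1) i c s)) =
      (1 : Matrix (Fin k) (Fin k) A).updateRow i (y c) := by
    ext s j
    by_cases hs : s = i
    · subst hs; simp
    · rw [Function.update_of_ne hs, hid, Matrix.updateRow_ne hs, Matrix.one_apply]
      simp only [eq_comm]
  change Matrix.det (fun s => y (Function.update (fun s : Fin k => m + s.1) i c s)) = _
  rw [h, ← Matrix.cramer_transpose_apply, Matrix.transpose_one, Matrix.cramer_one]
  rfl

theorem mem_span_chains {y : ℕ → Fin k → A} {n : ℕ}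
    (hid : ∀ s i : Fin k, y (2 * n + s) i = if i = s then 1 else 0)
    (hy : ∀ i j, ∑ u ∈ Finset.range n,
      (y (2 * u) i * y (2 * u + 1) j - y (2 * u) j * y (2 * u + 1) i) = 0)
    (hgen : Algebra.adjoin ℂ {a | ∃ c < 2 * n, ∃ i, a = y c i} = ⊤) (a : A) :
    a ∈ Submodule.span ℂ {b | ∃ t : Multiset (Fin k → ℕ),
      (∀ x ∈ t, x ∈ columnSets k (2 * n + k) ∧ x ∈ isotropicSets k n) ∧
      (∀ x ∈ t, ∀ z ∈ t, x ≤ z ∨ z ≤ x) ∧ b = (t.map (maxMinor y)).prod} := by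
  have hadj : a ∈ Algebra.adjoin ℂ (maxMinor y '' columnSets k (2 * n + k)) := by
    have : a ∈ (⊤ : Subalgebra ℂ A) := trivial
    rw [← hgen] at this
    refine Algebra.adjoin_le ?_ this
    rintro _ ⟨c, hc, i, rfl⟩
    rw [← maxMinor_update_eq hid c i]
    rcases exists_strictMono_maxMinor y (N := 2 * n + k)
      (f := Function.update (fun s : Fin k => 2 * n + s.1) i c) (fun s => by
        by_cases hs : s = i
        · subst hs; rw [Function.update_self]; omega
        · rw [Function.update_of_ne hs]; omega) with h | ⟨K, hK, _, h | h⟩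
    · rw [h]; exact zero_mem _
    · rw [h]; exact Algebra.subset_adjoin ⟨K, hK, rfl⟩
    · rw [h]; exact neg_mem (Algebra.subset_adjoin ⟨K, hK, rfl⟩)
  refine Submodule.span_le.mpr ?_ (mem_span_prod_of_mem_adjoin _ _ hadj)
  rintro _ ⟨s, hs, rfl⟩
  exact prod_mem_span_chains (maxMinor y) binWeight (columnSets k (2 * n + k)) (isotropicSets k n)
    (le := (· ≤ ·)) le_refl (fun x hx => binWeight_le hx.2)
    (fun x hx hxL => by
      obtain ⟨p, hp, hlt⟩ := exists_card_lt_of_notMem_isotropicSets hx hxL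
      exact maxMinor_mem_span_of_card_lt y (by omega) hp hy hx hlt)
    (fun x hx z hz h1 h2 => maxMinor_mul_mem_span y hx hz h1 h2) s hs

end ChainSpanning

section Parametrization

open MvPolynomial

/-- The weight of the entry in row `r` and column `c`; it decides which term of a maximal minor
leads. -/
def entryWeight (k n r c : ℕ) : ℤ := ((k : ℤ) - r) * (2 * n + r - c)

/-- The weights of the row scalings `Sum.inl r` and of the free entries `Sum.inr (r, c)`. -/
def varWeight (k n : ℕ) : ℕ ⊕ ℕ × ℕ → ℤ
  | Sum.inl r => entryWeight k n r (2 * r)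
  | Sum.inr (r, c) =>
    if c < 2 * n then entryWeight k n r c - entryWeight k n r (2 * r) else entryWeight k n r c

/-- The entries of the `s`-th row of a generic isotropic frame with pivots in the even columns. -/
def isoRow (n s c : ℕ) : MvPolynomial (ℕ ⊕ ℕ × ℕ) ℂ :=
  if c = 2 * s then 1 else if 2 * s < c then X (Sum.inr (s, c)) else if c % 2 = 0 then 0 else
    -∑ v ∈ (Finset.Ico (c / 2 + 1) n).attach,
      (X (Sum.inr (c / 2, 2 * v.1)) * isoRow n s (2 * v.1 + 1) -
        X (Sum.inr (c / 2, 2 * v.1 + 1)) * isoRow n s (2 * v.1))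
termination_by 2 * n - c
decreasing_by
  all_goals
    have := Finset.mem_Ico.mp v.2
    omega

theorem isoRow_pivot (n s : ℕ) : isoRow n s (2 * s) = 1 := by rw [isoRow, if_pos rfl]

theorem isoRow_of_lt {n s c : ℕ} (h : 2 * s < c) : isoRow n s c = X (Sum.inr (s, c)) := by
  rw [isoRow, if_neg (by omega), if_pos h]

theorem isoRow_even {n s u : ℕ} (h : u < s) : isoRow n s (2 * u) = 0 := by
  rw [isoRow, if_neg (by omega), if_neg (by omega), if_pos (by omega)]

theorem isoRow_odd {n s u : ℕ} (h : u < s) : isoRow n s (2 * u + 1) =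
    -∑ v ∈ Finset.Ico (u + 1) n, (X (Sum.inr (u, 2 * v)) * isoRow n s (2 * v + 1) -
        X (Sum.inr (u, 2 * v + 1)) * isoRow n s (2 * v)) := by
  rw [isoRow, if_neg (by omega), if_neg (by omega), if_neg (by omega),
    show (2 * u + 1) / 2 = u by omega]
  rw [Finset.sum_attach (Finset.Ico (u + 1) n) fun v =>
    X (Sum.inr (u, 2 * v)) * isoRow n s (2 * v + 1) -
        X (Sum.inr (u, 2 * v + 1)) * isoRow n s (2 * v)]

theorem isoRow_mem_weightLE {k n s : ℕ} (hs : s < k) (m c : ℕ) (hm : 2 * n - c ≤ m)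
    (hc : c < 2 * n) :
    isoRow n s c ∈ weightLE (varWeight k n) (entryWeight k n s c - entryWeight k n s (2 * s)) := by
  induction m generalizing c with
  | zero => omega
  | succ m ih =>
    rcases lt_trichotomy c (2 * s) with h | rfl | h
    · rcases Nat.even_or_odd' c with ⟨u, rfl | rfl⟩
      · rw [isoRow_even (by omega)]
        exact zero_mem _
      · rw [isoRow_odd (by omega)]
        refine neg_mem (sum_mem fun v hv => ?_)
        rw [Finset.mem_Ico] at hv
        have hX : ∀ c', c' < 2 * n → (X (Sum.inr (u, c')) : MvPolynomial (ℕ ⊕ ℕ × ℕ) ℂ) ∈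
            weightLE (varWeight k n) (entryWeight k n u c' - entryWeight k n u (2 * u)) :=
          fun c' h' => X_mem_weightLE (by simp [varWeight, h'])
        have hku : (0 : ℤ) ≤ (k : ℤ) - u := by omega
        have hks : (0 : ℤ) ≤ (k : ℤ) - s := by omega
        have hv1 : (0 : ℤ) ≤ (v : ℤ) - u - 1 := by omega
        refine sub_mem
          (weightLE_mono ?_ (mul_mem_weightLE (hX _ (by omega)) (ih (2 * v + 1) (by omega)
            (by omega))))
          (weightLE_mono ?_ (mul_mem_weightLE (hX _ (by omega)) (ih (2 * v) (by omega)
            (by omega))))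
        · simp only [entryWeight]
          push_cast
          nlinarith [mul_nonneg hku hv1, mul_nonneg hks hv1]
        · simp only [entryWeight]
          push_cast
          nlinarith [mul_nonneg hku hv1, mul_nonneg hks hv1]
    · rw [isoRow_pivot]
      exact one_mem_weightLE (by omega)
    · rw [isoRow_of_lt h]
      exact X_mem_weightLE (by simp [varWeight, hc])

theorem isoRow_isotropic_of_lt {n s u : ℕ} (hu : u < s) (hs : s < n) :
    ∑ v ∈ Finset.range n, (isoRow n u (2 * v) * isoRow n s (2 * v + 1) -
      isoRow n s (2 * v) * isoRow n u (2 * v + 1)) = 0 := by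
  have h1 : ∑ v ∈ Finset.range u, (isoRow n u (2 * v) * isoRow n s (2 * v + 1) -
      isoRow n s (2 * v) * isoRow n u (2 * v + 1)) = 0 := by
    refine Finset.sum_eq_zero fun v hv => ?_
    rw [Finset.mem_range] at hv
    rw [isoRow_even hv, isoRow_even (hv.trans hu), zero_mul, zero_mul, sub_zero]
  have h2 : ∑ v ∈ Finset.Ico (u + 1) n, (isoRow n u (2 * v) * isoRow n s (2 * v + 1) -
      isoRow n s (2 * v) * isoRow n u (2 * v + 1)) = -isoRow n s (2 * u + 1) := by
    rw [isoRow_odd hu, neg_neg]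
    refine Finset.sum_congr rfl fun v hv => ?_
    rw [Finset.mem_Ico] at hv
    rw [isoRow_of_lt (by omega : 2 * u < 2 * v), isoRow_of_lt (by omega : 2 * u < 2 * v + 1),
      mul_comm (isoRow n s (2 * v))]
  rw [← Finset.sum_range_add_sum_Ico _ (hu.trans hs).le, h1, Finset.sum_eq_sum_Ico_succ_bot
    (hu.trans hs), h2, isoRow_pivot, isoRow_even hu]
  ring

theorem isoRow_isotropic {n s u : ℕ} (hu : u < n) (hs : s < n) :
    ∑ v ∈ Finset.range n, (isoRow n u (2 * v) * isoRow n s (2 * v + 1) -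
      isoRow n s (2 * v) * isoRow n u (2 * v + 1)) = 0 := by
  rcases lt_trichotomy u s with h | rfl | h
  · exact isoRow_isotropic_of_lt h hs
  · exact Finset.sum_eq_zero fun v _ => by ring
  · rw [← neg_eq_zero, ← isoRow_isotropic_of_lt h hu, ← Finset.sum_neg_distrib]
    exact Finset.sum_congr rfl fun v _ => by ring

/-- The columns of a generic matrix `(Z₁ | Z₂)` with isotropic rows in `Z₁` and unitriangular
`Z₂`. -/
def echelon (k n c : ℕ) (r : Fin k) : MvPolynomial (ℕ ⊕ ℕ × ℕ) ℂ :=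
  if c < 2 * n then if r.1 < n then X (Sum.inl r.1) * isoRow n r c else 0
  else if c = 2 * n + r then 1 else if c < 2 * n + r then X (Sum.inr (r.1, c)) else 0

theorem echelon_isotropic (k n : ℕ) (i j : Fin k) :
    ∑ u ∈ Finset.range n, (echelon k n (2 * u) i * echelon k n (2 * u + 1) j -
      echelon k n (2 * u) j * echelon k n (2 * u + 1) i) = 0 := by
  have h1 : ∀ u ∈ Finset.range n, ∀ r, echelon k n (2 * u) r =
      if r.1 < n then X (Sum.inl r.1) * isoRow n r (2 * u) else 0 := by
    intro u hu r
    rw [Finset.mem_range] at hu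
    rw [echelon, if_pos (by omega)]
  have h2 : ∀ u ∈ Finset.range n, ∀ r, echelon k n (2 * u + 1) r =
      if r.1 < n then X (Sum.inl r.1) * isoRow n r (2 * u + 1) else 0 := by
    intro u hu r
    rw [Finset.mem_range] at hu
    rw [echelon, if_pos (by omega)]
  rw [Finset.sum_congr rfl fun u hu => by rw [h1 u hu, h1 u hu, h2 u hu, h2 u hu]]
  by_cases hi : i.1 < n
  · by_cases hj : j.1 < n
    · simp only [if_pos hi, if_pos hj]
      rw [← mul_zero (X (Sum.inl i.1) * X (Sum.inl j.1)), ← isoRow_isotropic hi hj, Finset.mul_sum]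
      exact Finset.sum_congr rfl fun u _ => by ring
    · simp [hj]
  · simp [hi]

theorem echelon_mem_weightLE (k n c : ℕ) (r : Fin k) :
    echelon k n c r ∈ weightLE (varWeight k n) (entryWeight k n r c) := by
  unfold echelon
  split_ifs with h1 h2 h3 h4
  · refine weightLE_mono ?_ (mul_mem_weightLE (X_mem_weightLE le_rfl)
      (isoRow_mem_weightLE r.2 _ c le_rfl h1))
    simp [varWeight]
  · exact zero_mem _
  · refine one_mem_weightLE ?_
    rw [h3, entryWeight]
    push_cast
    simp
  · exact X_mem_weightLE (by simp [varWeight, h1])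
  · exact zero_mem _

/-- The exponent of the leading entry in row `r` and column `c`. -/
def entryExponent (n r c : ℕ) : ℕ ⊕ ℕ × ℕ →₀ ℕ :=
  if c < 2 * n then
    Finsupp.single (Sum.inl r) 1 + if c = 2 * r then 0 else Finsupp.single (Sum.inr (r, c)) 1
  else if c = 2 * n + r then 0 else Finsupp.single (Sum.inr (r, c)) 1

theorem weight_entryExponent (k n r c : ℕ) :
    Finsupp.weight (varWeight k n) (entryExponent n r c) = entryWeight k n r c := by
  unfold entryExponent
  split_ifs with h1 h2 h3
  · simp [Finsupp.weight_single, varWeight, h2]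
  · simp [Finsupp.weight_single, varWeight, h1]
  · rw [h3, entryWeight]
    push_cast
    simp
  · simp [Finsupp.weight_single, varWeight, h1]

theorem echelon_eq_monomial {k n c : ℕ} {r : Fin k} (h1 : c < 2 * n → r.1 < n ∧ 2 * r.1 ≤ c)
    (h2 : c ≤ 2 * n + r) : echelon k n c r = monomial (entryExponent n r c) 1 := by
  unfold echelon entryExponent
  by_cases hc : c < 2 * n
  · rw [if_pos hc, if_pos hc, if_pos (h1 hc).1]
    by_cases h : c = 2 * r
    · rw [if_pos h, h, isoRow_pivot, mul_one, add_zero]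
      rfl
    · have := (h1 hc).2
      rw [if_neg h, isoRow_of_lt (by omega), ← one_mul (1 : ℂ), ← monomial_mul]
      rfl
  · rw [if_neg hc, if_neg hc]
    by_cases h : c = 2 * n + r
    · rw [if_pos h, if_pos h]
      rfl
    · rw [if_neg h, if_neg h, if_pos (by omega)]
      rfl

/-- The leading exponent of the maximal minor with columns `K`. -/
def minorExponent {k : ℕ} (n : ℕ) (K : Fin k → ℕ) : ℕ ⊕ ℕ × ℕ →₀ ℕ :=
  ∑ r : Fin k, entryExponent n r (K r)

theorem weight_minorExponent {k : ℕ} (n : ℕ) (K : Fin k → ℕ) :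
    Finsupp.weight (varWeight k n) (minorExponent n K) = ∑ r : Fin k, entryWeight k n r (K r) := by
  simp only [minorExponent, map_sum, weight_entryExponent]

theorem add_le_of_mem_columnSets {k N : ℕ} {K : Fin k → ℕ} (hK : K ∈ columnSets k (N + k))
    (r : Fin k) : K r ≤ N + r := by
  have h : ∀ m (s : Fin k), k - s.1 ≤ m → K s ≤ N + s := by
    intro m
    induction m with
    | zero => intro s hs; omega
    | succ m ih =>
      intro s hs
      by_cases h : s.1 + 1 < k
      · have h1 := ih ⟨s.1 + 1, h⟩ (by simp only; omega)
        have h2 := hK.1 (show s < ⟨s.1 + 1, h⟩ from Fin.lt_def.mpr (Nat.lt_succ_self _))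
        simp only at h1
        omega
      · have := hK.2 s
        omega
  exact h _ r le_rfl

theorem sum_entryWeight_perm_lt {k n : ℕ} {K : Fin k → ℕ} (hK : StrictMono K)
    {π : Equiv.Perm (Fin k)} (hπ : π ≠ 1) :
    ∑ r : Fin k, entryWeight k n r (K (π r)) < ∑ r : Fin k, entryWeight k n r (K r) := by
  have hmono : StrictMono fun r : Fin k => ((r.1 : ℤ) - k) := fun a b h => by
    have := Fin.lt_def.mp h
    simp only
    omega
  have hK' : StrictMono fun r : Fin k => (K r : ℤ) := fun a b h => by
    simpa using hK h
  have h1 : Monovary (fun r : Fin k => ((r.1 : ℤ) - k)) fun r : Fin k => (K r : ℤ) :=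
    hmono.monotone.monovary hK'.monotone
  have h2 := (h1.sum_mul_comp_perm_lt_sum_mul_iff (σ := π)).mpr (by
    intro h
    apply hπ
    have hm : Monotone π := by
      intro a b hab
      by_contra hlt
      push Not at hlt
      have := h (i := b) (j := a) (hK' hlt)
      have hle := hmono.le_iff_le.mp this
      have : a = b := le_antisymm hab hle
      subst this
      exact lt_irrefl _ hlt
    ext r
    have := Subsingleton.elim (hm.strictMono_of_injective π.injective |>.orderIsoOfSurjective π
      π.surjective) (OrderIso.refl _)
    have := congrArg (fun f => f r) this
    simpa using congrArg Fin.val this)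
  have h3 : ∀ f : Fin k → ℕ, ∑ r : Fin k, entryWeight k n r (f r) =
      ∑ r : Fin k, ((k : ℤ) - r) * (2 * n + r) + ∑ r : Fin k, ((r.1 : ℤ) - k) * f r := by
    intro f
    rw [← Finset.sum_add_distrib]
    exact Finset.sum_congr rfl fun r _ => by rw [entryWeight]; ring
  rw [h3, h3]
  simpa using h2

theorem isLead_maxMinor_echelon {k n : ℕ} {K : Fin k → ℕ} (hK : K ∈ columnSets k (2 * n + k))
    (hK' : K ∈ isotropicSets k n) :
    IsLead (varWeight k n) (maxMinor (echelon k n) K) (minorExponent n K) := by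
  have hdiag : ∏ r, echelon k n (K r) r = monomial (minorExponent n K) 1 := by
    rw [Finset.prod_congr rfl fun r _ =>
      echelon_eq_monomial (hK' r) (add_le_of_mem_columnSets hK r)]
    rw [minorExponent, monomial_sum_one]
  unfold IsLead
  change Matrix.det (Matrix.of fun i => echelon k n (K i)) - _ ∈ _
  rw [Matrix.det_apply, ← Finset.add_sum_erase _ _ (Finset.mem_univ (1 : Equiv.Perm (Fin k)))]
  simp only [Equiv.Perm.sign_one, one_smul, Equiv.Perm.one_apply, Matrix.of_apply]
  rw [hdiag, add_sub_cancel_left]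
  refine sum_mem fun π hπ => ?_
  have h1 : ∏ r, echelon k n (K (π r)) r ∈ weightLE (varWeight k n)
      (Finsupp.weight (varWeight k n) (minorExponent n K) - 1) := by
    refine weightLE_mono ?_ (prod_mem_weightLE _ _ _ fun r _ => echelon_mem_weightLE k n _ r)
    rw [weight_minorExponent]
    have := sum_entryWeight_perm_lt (n := n) hK.1 (Finset.ne_of_mem_erase hπ)
    omega
  rcases Int.units_eq_one_or (Equiv.Perm.sign π) with h | h <;> rw [h]
  · simpa using h1
  · simpa using neg_mem h1

theorem weight_minorExponent_pos {k n : ℕ} (hk : 0 < k) {K : Fin k → ℕ}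
    (hK : K ∈ columnSets k (2 * n + k)) (h0 : K ⟨0, hk⟩ < 2 * n) :
    0 < Finsupp.weight (varWeight k n) (minorExponent n K) := by
  rw [weight_minorExponent]
  refine Finset.sum_pos' (fun r _ => ?_) ⟨⟨0, hk⟩, Finset.mem_univ _, ?_⟩
  · have := add_le_of_mem_columnSets hK r
    exact mul_nonneg (by omega) (by omega)
  · exact mul_pos (by simp only; omega) (by simp only; omega)

end Parametrization

section ChainsDetermined

theorem Multiset.eq_of_card_of_count {α : Type*} [DecidableEq α] {a b : Multiset α} (z : α)
    (hcard : a.card = b.card) (h : ∀ c, c ≠ z → a.count c = b.count c) : a = b := by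
  have hf : a.filter (· ≠ z) = b.filter (· ≠ z) := by
    ext c
    by_cases hc : c = z
    · simp [hc]
    · simp [hc, h c hc]
  have key : ∀ d : Multiset α, d.card = d.count z + (d.filter (· ≠ z)).card := by
    intro d
    have h1 := congrArg Multiset.card (Multiset.filter_add_not (· ≠ z) d)
    have h2 : d.filter (fun x => ¬ x ≠ z) = d.filter (z = ·) := by
      refine Multiset.filter_congr fun x _ => ?_
      rw [not_not, eq_comm]
    rw [Multiset.card_add, h2, ← Multiset.countP_eq_card_filter (p := (z = ·))] at h1
    rw [← h1, add_comm]
    rfl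
  ext c
  by_cases hc : c = z
  · have h1 := key a
    have h2 := key b
    rw [hf] at h1
    rw [hc]
    omega
  · exact h c hc

theorem Multiset.exists_forall_le_of_chain {α : Type*} [Preorder α] {s : Multiset α}
    (hs : ∀ x ∈ s, ∀ y ∈ s, x ≤ y ∨ y ≤ x) (h0 : s ≠ 0) : ∃ x ∈ s, ∀ y ∈ s, x ≤ y := by
  induction s using Multiset.induction_on with
  | empty => exact absurd rfl h0
  | cons a s ih =>
    by_cases h : s = 0
    · subst h
      exact ⟨a, by simp, by simp⟩
    · obtain ⟨x, hx, hmin⟩ := ih (fun x hx y hy => hs x (Multiset.mem_cons_of_mem hx) y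
        (Multiset.mem_cons_of_mem hy)) h
      rcases hs x (Multiset.mem_cons_of_mem hx) a (Multiset.mem_cons_self a s) with h1 | h1
      · refine ⟨x, Multiset.mem_cons_of_mem hx, fun y hy => ?_⟩
        rcases Multiset.mem_cons.mp hy with rfl | hy
        · exact h1
        · exact hmin y hy
      · refine ⟨a, Multiset.mem_cons_self a s, fun y hy => ?_⟩
        rcases Multiset.mem_cons.mp hy with rfl | hy
        · exact le_rfl
        · exact h1.trans (hmin y hy)

/-- A chain of tuples is determined by the multisets of its coordinates. -/
theorem Multiset.eq_of_chain_of_map_eq {ι α : Type*} [Nonempty ι] [PartialOrder α] (m : ℕ)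
    {s t : Multiset (ι → α)} (hm : s.card = m) (hs : ∀ x ∈ s, ∀ y ∈ s, x ≤ y ∨ y ≤ x)
    (ht : ∀ x ∈ t, ∀ y ∈ t, x ≤ y ∨ y ≤ x) (h : ∀ r, s.map (· r) = t.map (· r)) : s = t := by
  classical
  induction m generalizing s t with
  | zero =>
    obtain ⟨r⟩ := ‹Nonempty ι›
    have h1 := congrArg Multiset.card (h r)
    rw [Multiset.card_map, Multiset.card_map, hm] at h1
    rw [Multiset.card_eq_zero.mp hm, Multiset.card_eq_zero.mp h1.symm]
  | succ m ih =>
    have hcard : s.card = t.card := by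
      obtain ⟨r⟩ := ‹Nonempty ι›
      have h1 := congrArg Multiset.card (h r)
      rwa [Multiset.card_map, Multiset.card_map] at h1
    obtain ⟨x, hx, hxs⟩ := Multiset.exists_forall_le_of_chain hs
      (by rintro rfl; simp at hm)
    obtain ⟨y, hy, hyt⟩ := Multiset.exists_forall_le_of_chain ht
      (by rintro rfl; rw [hm] at hcard; simp at hcard)
    have hxy : x = y := by
      funext r
      apply le_antisymm
      · have : y r ∈ s.map (· r) := h r ▸ Multiset.mem_map_of_mem (· r) hy
        obtain ⟨z, hz, hzr⟩ := Multiset.mem_map.mp this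
        rw [← hzr]
        exact hxs z hz r
      · have : x r ∈ t.map (· r) := h r ▸ Multiset.mem_map_of_mem (· r) hx
        obtain ⟨z, hz, hzr⟩ := Multiset.mem_map.mp this
        rw [← hzr]
        exact hyt z hz r
    subst hxy
    obtain ⟨s, rfl⟩ := Multiset.exists_cons_of_mem hx
    obtain ⟨t, rfl⟩ := Multiset.exists_cons_of_mem hy
    rw [Multiset.card_cons, Nat.succ_inj] at hm
    rw [ih hm (fun a ha b hb => hs a (Multiset.mem_cons_of_mem ha) b (Multiset.mem_cons_of_mem hb))
      (fun a ha b hb => ht a (Multiset.mem_cons_of_mem ha) b (Multiset.mem_cons_of_mem hb))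
      fun r => by simpa using h r]

variable {k n : ℕ}

theorem entryExponent_inl (r s c : ℕ) :
    entryExponent n r c (Sum.inl s) = if r = s ∧ c < 2 * n then 1 else 0 := by
  unfold entryExponent
  split_ifs with h1 h2 h3 h4 h5 h6 <;> simp_all

theorem entryExponent_inr (r s c d : ℕ) : entryExponent n r c (Sum.inr (s, d)) =
    if r = s ∧ c = d ∧ ¬ (c < 2 * n ∧ c = 2 * r) ∧ c ≠ 2 * n + r then 1 else 0 := by
  unfold entryExponent
  by_cases h1 : c < 2 * n
  · have h3 : c ≠ 2 * n + r := by omega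
    by_cases h2 : c = 2 * r
    · simp [h2, show 2 * r < 2 * n by omega]
    · simp [h1, h2, h3, Finsupp.single_apply]
  · by_cases h3 : c = 2 * n + r
    · simp [h3]
    · simp [h1, h3, Finsupp.single_apply]

theorem minorExponent_inl (K : Fin k → ℕ) (r : Fin k) :
    minorExponent n K (Sum.inl r.1) = if K r < 2 * n then 1 else 0 := by
  rw [minorExponent, Finsupp.finsetSum_apply, Finset.sum_eq_single r]
  · simp [entryExponent_inl]
  · intro s _ hs
    rw [entryExponent_inl, if_neg]
    exact fun h => hs (Fin.ext h.1)
  · simp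

theorem minorExponent_inr (K : Fin k → ℕ) (r : Fin k) {c : ℕ}
    (hc : ¬ (c < 2 * n ∧ c = 2 * r)) (hc' : c ≠ 2 * n + r) :
    minorExponent n K (Sum.inr (r.1, c)) = if c = K r then 1 else 0 := by
  rw [minorExponent, Finsupp.finsetSum_apply, Finset.sum_eq_single r]
  · rw [entryExponent_inr]
    by_cases h : c = K r
    · subst h; simp only [true_and, if_pos (And.intro hc hc')]; simp
    · rw [if_neg (fun h' => h h'.2.1.symm), if_neg h]
  · intro s _ hs
    rw [entryExponent_inr, if_neg]
    exact fun h => hs (Fin.ext h.1)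
  · simp

theorem Multiset.sum_map_ite_one {α : Type*} (p : α → Prop) [DecidablePred p] (s : Multiset α) :
    (s.map fun x => if p x then 1 else 0).sum = s.countP p := by
  induction s using Multiset.induction_on with
  | empty => simp
  | cons a s ih => by_cases h : p a <;> simp [h, ih, add_comm]

theorem sum_map_minorExponent_inl (s : Multiset (Fin k → ℕ)) (r : Fin k) :
    (s.map (minorExponent n)).sum (Sum.inl r.1) = (s.map (· r)).countP (· < 2 * n) := by
  rw [Multiset.countP_map, ← Multiset.countP_eq_card_filter, ← Multiset.sum_map_ite_one,
    ← Finsupp.applyAddHom_apply, map_multiset_sum, Multiset.map_map]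
  simp only [Function.comp_def, Finsupp.applyAddHom_apply, minorExponent_inl]

theorem sum_map_minorExponent_inr (s : Multiset (Fin k → ℕ)) (r : Fin k) {c : ℕ}
    (hc : ¬ (c < 2 * n ∧ c = 2 * r)) (hc' : c ≠ 2 * n + r) :
    (s.map (minorExponent n)).sum (Sum.inr (r.1, c)) = (s.map (· r)).count c := by
  rw [Multiset.count, Multiset.countP_map, ← Multiset.countP_eq_card_filter,
    ← Multiset.sum_map_ite_one, ← Finsupp.applyAddHom_apply, map_multiset_sum, Multiset.map_map]
  simp only [Function.comp_def, Finsupp.applyAddHom_apply, minorExponent_inr _ _ hc hc']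

theorem eq_of_sum_map_minorExponent_eq (hk : 0 < k) {s t : Multiset (Fin k → ℕ)}
    (hs0 : ∀ K ∈ s, K ⟨0, hk⟩ < 2 * n) (ht0 : ∀ K ∈ t, K ⟨0, hk⟩ < 2 * n)
    (hs : ∀ x ∈ s, ∀ y ∈ s, x ≤ y ∨ y ≤ x) (ht : ∀ x ∈ t, ∀ y ∈ t, x ≤ y ∨ y ≤ x)
    (h : (s.map (minorExponent n)).sum = (t.map (minorExponent n)).sum) : s = t := by
  have : Nonempty (Fin k) := ⟨⟨0, hk⟩⟩
  have hinl : ∀ r : Fin k, (s.map (· r)).countP (· < 2 * n) = (t.map (· r)).countP (· < 2 * n) := by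
    intro r
    rw [← sum_map_minorExponent_inl, h, sum_map_minorExponent_inl]
  have hinr : ∀ (r : Fin k) (c : ℕ), ¬ (c < 2 * n ∧ c = 2 * r) → c ≠ 2 * n + r →
      (s.map (· r)).count c = (t.map (· r)).count c := by
    intro r c h1 h2
    rw [← sum_map_minorExponent_inr s r h1 h2, h, sum_map_minorExponent_inr t r h1 h2]
  have hcard : s.card = t.card := by
    have key : ∀ u : Multiset (Fin k → ℕ), (∀ K ∈ u, K ⟨0, hk⟩ < 2 * n) →
        (u.map (· ⟨0, hk⟩)).countP (· < 2 * n) = u.card := by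
      intro u hu
      rw [Multiset.countP_eq_card.mpr, Multiset.card_map]
      intro c hc
      obtain ⟨K, hK, rfl⟩ := Multiset.mem_map.mp hc
      exact hu K hK
    rw [← key s hs0, ← key t ht0, hinl]
  refine Multiset.eq_of_chain_of_map_eq _ rfl hs ht fun r => ?_
  have h1 : (s.map (· r)).filter (· < 2 * n) = (t.map (· r)).filter (· < 2 * n) := by
    refine Multiset.eq_of_card_of_count (2 * r.1) ?_ fun c hc => ?_
    · rw [← Multiset.countP_eq_card_filter, ← Multiset.countP_eq_card_filter, hinl]
    · rw [Multiset.count_filter, Multiset.count_filter]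
      by_cases hcn : c < 2 * n
      · rw [if_pos hcn, if_pos hcn, hinr r c (fun h => hc h.2) (by omega)]
      · rw [if_neg hcn, if_neg hcn]
  have h2 : (s.map (· r)).filter (¬ · < 2 * n) = (t.map (· r)).filter (¬ · < 2 * n) := by
    refine Multiset.eq_of_card_of_count (2 * n + r.1) ?_ fun c hc => ?_
    · have e1 := congrArg Multiset.card (Multiset.filter_add_not (· < 2 * n) (s.map (· r)))
      have e2 := congrArg Multiset.card (Multiset.filter_add_not (· < 2 * n) (t.map (· r)))
      rw [Multiset.card_add, Multiset.card_map] at e1 e2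
      rw [h1] at e1
      omega
    · rw [Multiset.count_filter, Multiset.count_filter]
      by_cases hcn : c < 2 * n
      · rw [if_neg (not_not.mpr hcn), if_neg (not_not.mpr hcn)]
      · rw [if_pos hcn, if_pos hcn, hinr r c (fun h => hcn h.1) hc]
  rw [← Multiset.filter_add_not (· < 2 * n) (s.map (· r)), h1, h2, Multiset.filter_add_not]

end ChainsDetermined

section CoordinateRing

variable (k n : ℕ)

/-- The columns of the generic matrix over the coordinate ring of the nullcone, followed by the
columns of the identity matrix. -/
def nullCol (c : ℕ) (i : Fin k) : MvPolynomial (Fin k × Fin (2 * n)) ℂ ⧸ sympIdeal k n :=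
  if h : c < 2 * n then Ideal.Quotient.mk _ (MvPolynomial.X (i, ⟨c, h⟩))
  else if c = 2 * n + i then 1 else 0

variable {k n}

theorem nullCol_identity (s i : Fin k) : nullCol k n (2 * n + s) i = if i = s then 1 else 0 := by
  rw [nullCol, dif_neg (by omega)]
  simp only [add_right_inj, Fin.ext_iff, eq_comm]

theorem nullCol_isotropic (i j : Fin k) : ∑ u ∈ Finset.range n,
    (nullCol k n (2 * u) i * nullCol k n (2 * u + 1) j -
      nullCol k n (2 * u) j * nullCol k n (2 * u + 1) i) = 0 := by
  have key : ∀ i j : Fin k, ∑ u ∈ Finset.range n,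
      (nullCol k n (2 * u) i * nullCol k n (2 * u + 1) j -
        nullCol k n (2 * u) j * nullCol k n (2 * u + 1) i) =
      Ideal.Quotient.mk (sympIdeal k n) (rbase k n i j) := by
    intro i j
    rw [Finset.sum_range, rbase, map_sum]
    refine Finset.sum_congr rfl fun u _ => ?_
    have := u.2
    simp only [nullCol, dif_pos (show 2 * u.1 < 2 * n by omega),
      dif_pos (show 2 * u.1 + 1 < 2 * n by omega), map_sub, map_mul]
  have hlt : ∀ i j : Fin k, i < j → Ideal.Quotient.mk (sympIdeal k n) (rbase k n i j) = 0 :=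
    fun i j h => Ideal.Quotient.eq_zero_iff_mem.mpr (Ideal.subset_span ⟨i, j, h, rfl⟩)
  rcases lt_trichotomy i j with h | rfl | h
  · rw [key, hlt i j h]
  · exact Finset.sum_eq_zero fun u _ => sub_self _
  · rw [← neg_eq_zero, ← hlt j i h, ← key, ← Finset.sum_neg_distrib]
    exact Finset.sum_congr rfl fun u _ => by ring

theorem adjoin_nullCol :
    Algebra.adjoin ℂ {a | ∃ c < 2 * n, ∃ i, a = nullCol k n c i} = ⊤ := by
  rw [eq_top_iff]
  rintro a -
  obtain ⟨f, rfl⟩ := Ideal.Quotient.mk_surjective a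
  induction f using MvPolynomial.induction_on with
  | C r => exact Subalgebra.algebraMap_mem _ r
  | add p q hp hq => rw [map_add]; exact add_mem hp hq
  | mul_X p x hp =>
    rw [map_mul]
    refine mul_mem hp (Algebra.subset_adjoin ⟨x.2, x.2.2, x.1, ?_⟩)
    rw [nullCol, dif_pos x.2.2]

theorem sum_mulVec_isotropic {R : Type*} [CommRing R] (M : Matrix (Fin k) (Fin k) R)
    {y : ℕ → Fin k → R} (hy : ∀ i j, ∑ u ∈ Finset.range n,
      (y (2 * u) i * y (2 * u + 1) j - y (2 * u) j * y (2 * u + 1) i) = 0) (i j : Fin k) :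
    ∑ u ∈ Finset.range n, ((M.mulVec (y (2 * u))) i * (M.mulVec (y (2 * u + 1))) j -
      (M.mulVec (y (2 * u))) j * (M.mulVec (y (2 * u + 1))) i) = 0 := by
  have h : ∀ u, (M.mulVec (y (2 * u))) i * (M.mulVec (y (2 * u + 1))) j -
      (M.mulVec (y (2 * u))) j * (M.mulVec (y (2 * u + 1))) i = ∑ a, ∑ b, M i a * M j b *
        (y (2 * u) a * y (2 * u + 1) b - y (2 * u) b * y (2 * u + 1) a) := by
    intro u
    simp only [Matrix.mulVec, dotProduct]
    rw [Finset.sum_mul_sum, mul_comm (∑ x, M j x * y (2 * u) x), Finset.sum_mul_sum,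
      ← Finset.sum_sub_distrib]
    refine Finset.sum_congr rfl fun a _ => ?_
    rw [← Finset.sum_sub_distrib]
    exact Finset.sum_congr rfl fun b _ => by ring
  simp only [h]
  rw [Finset.sum_comm]
  refine Finset.sum_eq_zero fun a _ => ?_
  rw [Finset.sum_comm]
  refine Finset.sum_eq_zero fun b _ => ?_
  rw [← Finset.mul_sum, hy, mul_zero]

theorem maxMinor_mulVec {R : Type*} [CommRing R] (M : Matrix (Fin k) (Fin k) R)
    (y : ℕ → Fin k → R) (f : Fin k → ℕ) :
    maxMinor (fun c => M.mulVec (y c)) f = M.det * maxMinor y f := by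
  have h : (Matrix.of fun i => M.mulVec (y (f i))) =
      (Matrix.of fun i => y (f i)) * M.transpose := by
    ext i j
    simp [Matrix.mul_apply, Matrix.mulVec, dotProduct, mul_comm]
  change (Matrix.of fun i => M.mulVec (y (f i))).det = M.det * (Matrix.of fun i => y (f i)).det
  rw [h, Matrix.det_mul, Matrix.det_transpose, mul_comm]

theorem map_maxMinor {R S F : Type*} [CommRing R] [CommRing S] [FunLike F R S] [RingHomClass F R S]
    (φ : F) (y : ℕ → Fin k → R) (f : Fin k → ℕ) :
    φ (maxMinor y f) = maxMinor (fun c i => φ (y c i)) f :=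
  RingHom.map_det (φ : R →+* S) (Matrix.of fun i => y (f i))

variable (k n)

/-- The unitriangular block of the generic echelon matrix. -/
def echelonBlock : Matrix (Fin k) (Fin k) (MvPolynomial (ℕ ⊕ ℕ × ℕ) ℂ) :=
  Matrix.of fun i s => echelon k n (2 * n + s) i

theorem det_echelonBlock : (echelonBlock k n).det = 1 := by
  rw [Matrix.det_of_isLowerTriangular]
  · refine Finset.prod_eq_one fun i _ => ?_
    simp [echelonBlock, echelon]
  · intro i j hij
    have : i < j := hij
    rw [Fin.lt_def] at this
    simp only [echelonBlock, echelon, Matrix.of_apply]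
    rw [if_neg (by omega), if_neg (by omega), if_neg (by omega)]

/-- The columns of the echelon matrix normalized so that the last block is the identity. -/
def normCol (c : ℕ) : Fin k → MvPolynomial (ℕ ⊕ ℕ × ℕ) ℂ :=
  (echelonBlock k n)⁻¹.mulVec (echelon k n c)

theorem normCol_identity (s i : Fin k) : normCol k n (2 * n + s) i = if i = s then 1 else 0 := by
  have h : echelon k n (2 * n + s) = (echelonBlock k n).mulVec (Pi.single s 1) := by
    rw [Matrix.mulVec_single_one]
    rfl
  have hu : IsUnit (echelonBlock k n).det := by rw [det_echelonBlock]; exact isUnit_one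
  rw [normCol, h, Matrix.mulVec_mulVec, Matrix.nonsing_inv_mul _ hu, Matrix.one_mulVec,
    Pi.single_apply]

/-- The parametrization of the nullcone by normalized echelon matrices, as an algebra map into a
polynomial ring. -/
def nullParam : (MvPolynomial (Fin k × Fin (2 * n)) ℂ ⧸ sympIdeal k n) →ₐ[ℂ]
    MvPolynomial (ℕ ⊕ ℕ × ℕ) ℂ :=
  Ideal.Quotient.liftₐ _ (MvPolynomial.aeval fun x => normCol k n x.2 x.1) fun a ha => by
    have hle : sympIdeal k n ≤ RingHom.ker
        (MvPolynomial.aeval (R := ℂ) fun x : Fin k × Fin (2 * n) => normCol k n x.2 x.1) := by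
      refine Ideal.span_le.mpr ?_
      rintro _ ⟨i, j, _, rfl⟩
      have := sum_mulVec_isotropic (echelonBlock k n)⁻¹ (echelon_isotropic k n) i j
      rw [Finset.sum_range] at this
      simpa [rbase, RingHom.mem_ker, normCol] using this
    exact hle ha

variable {k n}

theorem nullParam_nullCol {c : ℕ} (hc : c < 2 * n + k) (i : Fin k) :
    nullParam k n (nullCol k n c i) = normCol k n c i := by
  by_cases h : c < 2 * n
  · rw [nullCol, dif_pos h]
    exact (MvPolynomial.aeval_X _ _)
  · obtain ⟨s, rfl⟩ : ∃ s : Fin k, c = 2 * n + s := ⟨⟨c - 2 * n, by omega⟩, by simp only; omega⟩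
    rw [nullCol_identity, normCol_identity]
    split_ifs <;> simp

theorem nullParam_maxMinor {K : Fin k → ℕ} (hK : ∀ r, K r < 2 * n + k) :
    nullParam k n (maxMinor (nullCol k n) K) = maxMinor (echelon k n) K := by
  have h1 : maxMinor (fun c i => nullParam k n (nullCol k n c i)) K =
      maxMinor (normCol k n) K := by
    unfold maxMinor
    congr 1
    funext r i
    exact nullParam_nullCol (hK r) i
  rw [map_maxMinor, h1]
  have h2 := maxMinor_mulVec (echelonBlock k n)⁻¹ (echelon k n) K
  rw [Matrix.det_nonsing_inv, det_echelonBlock, Ring.inverse_one, one_mul] at h2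
  exact h2

end CoordinateRing

section Tableaux

theorem List.eq_of_pairwise_lt_of_mem_iff {l l' : List ℕ} (h : l.Pairwise (· < ·))
    (h' : l'.Pairwise (· < ·)) (hm : ∀ x, x ∈ l ↔ x ∈ l') : l = l' :=
  ((List.perm_ext_iff_of_nodup (h.imp fun h => h.ne) (h'.imp fun h => h.ne)).mpr hm).eq_of_pairwise
    (fun _ _ _ _ h1 h2 => absurd h1 h2.asymm) h h'

theorem pairwise_range_succ (k : ℕ) : ((List.range k).map (· + 1)).Pairwise (· < ·) :=
  List.pairwise_map.mpr (List.pairwise_lt_range.imp fun h => Nat.succ_lt_succ h)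

theorem mem_range_succ {k x : ℕ} : x ∈ (List.range k).map (· + 1) ↔ 1 ≤ x ∧ x ≤ k := by
  rw [List.mem_map]
  constructor
  · rintro ⟨a, ha, rfl⟩
    rw [List.mem_range] at ha
    omega
  · rintro ⟨h1, h2⟩
    exact ⟨x - 1, List.mem_range.mpr (by omega), by omega⟩

theorem mem_xi {k m x : ℕ} {I J : List ℕ} : x ∈ xi k m I J ↔
    x ∈ J ∨ ∃ c, (1 ≤ c ∧ c ≤ k) ∧ c ∉ I ∧ m + (k + 1 - c) = x := by
  rw [xi, List.mem_append]
  simp only [List.mem_map (f := fun c => m + (k + 1 - c)), List.mem_reverse, List.mem_filter,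
    mem_range_succ, decide_eq_true_eq, and_assoc]

theorem mem_xiInvI {k m x : ℕ} {K : List ℕ} :
    x ∈ xiInvI k m K ↔ (1 ≤ x ∧ x ≤ k) ∧ m + (k + 1 - x) ∉ K := by
  rw [xiInvI, List.mem_filter, mem_range_succ, decide_eq_true_eq]

theorem mem_xiInvJ {m x : ℕ} {K : List ℕ} : x ∈ xiInvJ m K ↔ x ∈ K ∧ x ≤ m := by
  rw [xiInvJ, List.mem_filter, decide_eq_true_eq]

theorem pairwise_xi {k m : ℕ} {I J : List ℕ} (hJ : J.Pairwise (· < ·)) (hm : ∀ x ∈ J, x ≤ m) :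
    (xi k m I J).Pairwise (· < ·) := by
  rw [xi, List.pairwise_append]
  refine ⟨hJ, ?_, ?_⟩
  · rw [List.pairwise_map, List.pairwise_reverse]
    refine ((pairwise_range_succ k).filter _).imp_of_mem fun {a b} ha hb hab => ?_
    have h1 := mem_range_succ.mp (List.mem_filter.mp ha).1
    have h2 := mem_range_succ.mp (List.mem_filter.mp hb).1
    omega
  · intro a ha b hb
    obtain ⟨c, hc, rfl⟩ := List.mem_map.mp hb
    have h1 := mem_range_succ.mp (List.mem_filter.mp (List.mem_reverse.mp hc)).1
    have h2 := hm a ha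
    omega

theorem length_xi {k m : ℕ} {I J : List ℕ} (hI : I.Pairwise (· < ·))
    (hk : ∀ x ∈ I, 1 ≤ x ∧ x ≤ k) : (xi k m I J).length + I.length = J.length + k := by
  have h1 : ((List.range k).map (· + 1)).filter (fun c => decide (c ∈ I)) = I := by
    refine List.eq_of_pairwise_lt_of_mem_iff ((pairwise_range_succ k).filter _) hI fun x => ?_
    rw [List.mem_filter, mem_range_succ, decide_eq_true_eq]
    exact ⟨fun h => h.2, fun h => ⟨hk x h, h⟩⟩
  have h2 := List.length_eq_length_filter_add (l := (List.range k).map (· + 1))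
    (fun c => decide (c ∈ I))
  rw [h1, List.length_map, List.length_range] at h2
  simp only [← decide_not] at h2
  rw [xi, List.length_append, List.length_map, List.length_reverse]
  omega

theorem xiInvI_xi {k m : ℕ} {I J : List ℕ} (h : isTab k m I J) : xiInvI k m (xi k m I J) = I := by
  obtain ⟨_, _, hI, _, hk, hm⟩ := h
  refine List.eq_of_pairwise_lt_of_mem_iff ((pairwise_range_succ k).filter _)
    (List.isChain_iff_pairwise.mp hI) fun x => ?_
  rw [mem_xiInvI, mem_xi]
  constructor
  · rintro ⟨hx, h⟩
    by_contra hxI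
    exact h (Or.inr ⟨x, hx, hxI, rfl⟩)
  · intro hx
    have h1 := hk x hx
    refine ⟨h1, ?_⟩
    rintro (h | ⟨c, hc, hcI, hcx⟩)
    · have := hm _ h
      omega
    · rw [show c = x by omega] at hcI
      exact hcI hx

theorem xiInvJ_xi {k m : ℕ} {I J : List ℕ} (h : isTab k m I J) : xiInvJ m (xi k m I J) = J := by
  obtain ⟨_, _, _, hJ, _, hm⟩ := h
  have hJ' := List.isChain_iff_pairwise.mp hJ
  refine List.eq_of_pairwise_lt_of_mem_iff ((pairwise_xi hJ' fun x hx => (hm x hx).2).filter _)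
    hJ' fun x => ?_
  rw [mem_xiInvJ, mem_xi]
  constructor
  · rintro ⟨h | ⟨c, hc, _, rfl⟩, hx⟩
    · exact h
    · omega
  · exact fun h => ⟨Or.inl h, (hm x h).2⟩

theorem xi_xiInv {k m : ℕ} {K : List ℕ} (hK : K.Pairwise (· < ·)) (hm : ∀ x ∈ K, x ≤ m + k) :
    xi k m (xiInvI k m K) (xiInvJ m K) = K := by
  refine List.eq_of_pairwise_lt_of_mem_iff (pairwise_xi (hK.filter _)
    fun x hx => (mem_xiInvJ.mp hx).2) hK fun x => ?_
  simp only [mem_xi, mem_xiInvJ, mem_xiInvI]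
  constructor
  · rintro (h | ⟨c, hc, hcK, rfl⟩)
    · exact h.1
    · by_contra h
      exact hcK ⟨hc, h⟩
  · intro hx
    by_cases h : x ≤ m
    · exact Or.inl ⟨hx, h⟩
    · have := hm x hx
      refine Or.inr ⟨m + k + 1 - x, by omega, fun h' => h'.2 ?_, by omega⟩
      rwa [show m + (k + 1 - (m + k + 1 - x)) = x by omega]

theorem isTab_xiInv {k m : ℕ} {K : List ℕ} (hK : K.Pairwise (· < ·))
    (hm : ∀ x ∈ K, 1 ≤ x ∧ x ≤ m + k) (hlen : K.length = k) (h0 : ∃ x ∈ K, x ≤ m) :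
    isTab k m (xiInvI k m K) (xiInvJ m K) := by
  have hI : (xiInvI k m K).Pairwise (· < ·) := (pairwise_range_succ k).filter _
  have h1 := length_xi (m := m) (J := xiInvJ m K) hI fun x hx => (mem_xiInvI.mp hx).1
  rw [xi_xiInv hK fun x hx => (hm x hx).2] at h1
  have hl : (xiInvI k m K).length = (xiInvJ m K).length := by omega
  obtain ⟨x, hx, hxm⟩ := h0
  refine ⟨hl, ?_, List.isChain_iff_pairwise.mpr hI, List.isChain_iff_pairwise.mpr (hK.filter _),
    fun x hx => (mem_xiInvI.mp hx).1, fun x hx => ?_⟩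
  · intro h
    rw [h, List.length_nil] at hl
    have := mem_xiInvJ.mpr ⟨hx, hxm⟩
    rw [List.length_eq_zero_iff.mp hl.symm] at this
    exact List.not_mem_nil this
  · have := mem_xiInvJ.mp hx
    exact ⟨(hm x this.1).1, this.2⟩

variable {k n : ℕ}

/-- The zero-based column tuple of a tableau. -/
def tabKey (k n : ℕ) (s : List ℕ × List ℕ) (r : Fin k) : ℕ := (xi k (2 * n) s.1 s.2).getD r 0 - 1

/-- The tableau of a zero-based column tuple. -/
def tabOf (k n : ℕ) (K : Fin k → ℕ) : List ℕ × List ℕ :=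
  (xiInvI k (2 * n) (List.ofFn fun r => K r + 1), xiInvJ (2 * n) (List.ofFn fun r => K r + 1))

variable (k n) in
/-- The column tuples of the tableaux in `D(N)`. -/
def keySets : Set (Fin k → ℕ) :=
  {K | K ∈ columnSets k (2 * n + k) ∧ K ∈ isotropicSets k n ∧ ∃ r, K r < 2 * n}

theorem length_xi_of_isTab {m : ℕ} {I J : List ℕ} (h : isTab k m I J) :
    (xi k m I J).length = k := by
  have := length_xi (m := m) (J := J) (List.isChain_iff_pairwise.mp h.2.2.1) h.2.2.2.2.1
  have := h.1
  omega

theorem one_le_of_mem_xi {m x : ℕ} {I J : List ℕ} (h : isTab k m I J) (hx : x ∈ xi k m I J) :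
    1 ≤ x ∧ x ≤ m + k := by
  rcases mem_xi.mp hx with hx | ⟨c, hc, _, rfl⟩
  · have := h.2.2.2.2.2 x hx
    omega
  · omega

theorem ofFn_tabKey {s : List ℕ × List ℕ} (h : isTab k (2 * n) s.1 s.2) :
    (List.ofFn fun r => tabKey k n s r + 1) = xi k (2 * n) s.1 s.2 := by
  refine List.ext_getElem (by rw [List.length_ofFn, length_xi_of_isTab h]) fun i h1 h2 => ?_
  have := one_le_of_mem_xi h (List.getElem_mem h2)
  rw [List.getElem_ofFn, tabKey, List.getD_eq_getElem _ _ h2]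
  omega

theorem tabOf_tabKey {s : List ℕ × List ℕ} (h : isTab k (2 * n) s.1 s.2) :
    tabOf k n (tabKey k n s) = s := by
  rw [tabOf, ofFn_tabKey h, xiInvI_xi h, xiInvJ_xi h]

theorem tabKey_mem {s : List ℕ × List ℕ} (h : isTabN k n s.1 s.2) : tabKey k n s ∈ keySets k n := by
  obtain ⟨ht, _, hJn, hJ⟩ := h
  have hlen := length_xi_of_isTab ht
  have hlt : ∀ {r : ℕ}, r < k → r < (xi k (2 * n) s.1 s.2).length := fun h => h.trans_eq hlen.symm
  have hval : ∀ (r : ℕ) (hr : r < k), (xi k (2 * n) s.1 s.2)[r]'(hlt hr) =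
      tabKey k n s ⟨r, hr⟩ + 1 := by
    intro r hr
    have := one_le_of_mem_xi ht (List.getElem_mem (hlt hr))
    rw [tabKey, List.getD_eq_getElem _ _ (hlt hr)]
    omega
  have hp := pairwise_xi (k := k) (I := s.1) (List.isChain_iff_pairwise.mp ht.2.2.2.1)
    fun x hx => (ht.2.2.2.2.2 x hx).2
  have hxi : ∀ (r : ℕ) (hr : r < k) (hrJ : r < s.2.length), s.2[r] = tabKey k n s ⟨r, hr⟩ + 1 := by
    intro r hr hrJ
    rw [← hval r hr]
    simp only [xi]
    rw [List.getElem_append_left hrJ]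
  refine ⟨⟨fun a b hab => ?_, fun r => ?_⟩, fun r hr => ?_, ?_⟩
  · have := List.pairwise_iff_getElem.mp hp a b (hlt a.2) (hlt b.2) hab
    rw [hval a a.2, hval b b.2] at this
    simpa using this
  · have := one_le_of_mem_xi ht (List.getElem_mem (hlt r.2))
    rw [hval r r.2] at this
    simp only [Fin.eta] at this
    omega
  · have hrJ : r.1 < s.2.length := by
      by_contra hge
      have h1 := hval r r.2
      simp only [xi] at h1
      rw [List.getElem_append_right (by omega), List.getElem_map] at h1
      have h2 := mem_range_succ.mp (List.mem_filter.mp (List.mem_reverse.mp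
        (List.getElem_mem (l := (((List.range k).map (· + 1)).filter
          fun c => decide (c ∉ s.1)).reverse) (n := r.1 - s.2.length) (by
            have := hlen
            rw [xi, List.length_append, List.length_map] at this
            omega)))).1
      simp only [Fin.eta] at h1
      omega
    refine ⟨by omega, ?_⟩
    have h1 := hJ r hrJ
    rw [List.getD_eq_getElem _ _ hrJ, hxi r r.2 hrJ] at h1
    simp only [Fin.eta] at h1
    omega
  · have h0 : 0 < s.2.length := by
      rw [← ht.1]
      exact List.length_pos_iff.mpr ht.2.1
    have hk : 0 < k := by
      obtain ⟨x, hx⟩ := List.exists_mem_of_ne_nil _ ht.2.1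
      have := ht.2.2.2.2.1 x hx
      omega
    refine ⟨⟨0, hk⟩, ?_⟩
    have h1 := ht.2.2.2.2.2 _ (List.getElem_mem h0)
    rw [hxi 0 hk h0] at h1
    omega

theorem xi_tabOf {K : Fin k → ℕ} (hK : K ∈ keySets k n) :
    xi k (2 * n) (tabOf k n K).1 (tabOf k n K).2 = List.ofFn fun r => K r + 1 := by
  refine xi_xiInv (List.pairwise_ofFn.mpr fun i j hij => Nat.succ_lt_succ (hK.1.1 hij)) ?_
  intro x hx
  obtain ⟨r, rfl⟩ := List.mem_ofFn.mp hx
  exact hK.1.2 r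

theorem tabKey_tabOf {K : Fin k → ℕ} (hK : K ∈ keySets k n) : tabKey k n (tabOf k n K) = K := by
  funext r
  rw [tabKey, xi_tabOf hK, List.getD_eq_getElem _ _ (by rw [List.length_ofFn]; exact r.2),
    List.getElem_ofFn, Nat.add_sub_cancel]

theorem isTabN_tabOf {K : Fin k → ℕ} (hK : K ∈ keySets k n) :
    isTabN k n (tabOf k n K).1 (tabOf k n K).2 := by
  have ht : isTab k (2 * n) (tabOf k n K).1 (tabOf k n K).2 := by
    refine isTab_xiInv (List.pairwise_ofFn.mpr fun i j hij => Nat.succ_lt_succ (hK.1.1 hij)) ?_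
      List.length_ofFn ?_
    · intro x hx
      obtain ⟨r, rfl⟩ := List.mem_ofFn.mp hx
      exact ⟨Nat.succ_pos _, hK.1.2 r⟩
    · obtain ⟨r, hr⟩ := hK.2.2
      exact ⟨K r + 1, List.mem_ofFn.mpr ⟨r, rfl⟩, hr⟩
  have hlen : (tabOf k n K).2.length ≤ k := by
    have := length_xi_of_isTab ht
    rw [xi, List.length_append] at this
    omega
  have hval : ∀ (r : ℕ) (hr : r < (tabOf k n K).2.length),
      (tabOf k n K).2[r] = K ⟨r, hr.trans_le hlen⟩ + 1 := by
    intro r hr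
    have h1 : (xi k (2 * n) (tabOf k n K).1 (tabOf k n K).2)[r]'(by
        rw [length_xi_of_isTab ht]; omega) = (tabOf k n K).2[r] := by
      simp only [xi]
      rw [List.getElem_append_left hr]
    rw [← h1]
    simp only [xi_tabOf hK, List.getElem_ofFn]
  have hle : ∀ (r : ℕ) (hr : r < (tabOf k n K).2.length), K ⟨r, hr.trans_le hlen⟩ < 2 * n := by
    intro r hr
    have := ht.2.2.2.2.2 _ (List.getElem_mem hr)
    rw [hval r hr] at this
    omega
  have hn : (tabOf k n K).2.length ≤ n := by
    by_contra h
    push Not at h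
    exact lt_irrefl _ (hK.2.1 _ (hle n h)).1
  refine ⟨ht, ?_, hn, fun r hr => ?_⟩
  · rw [ht.1]
    exact le_min hlen hn
  · rw [List.getD_eq_getElem _ _ hr, hval r hr]
    exact Nat.succ_le_succ (hK.2.1 _ (hle r hr)).2

theorem inf_mem_keySets {K L : Fin k → ℕ} (hK : K ∈ keySets k n) (hL : L ∈ keySets k n) :
    K ⊓ L ∈ keySets k n := by
  refine ⟨⟨fun a b hab => ?_, fun r => ?_⟩, fun r hr => ?_, ?_⟩
  · exact min_lt_min (hK.1.1 hab) (hL.1.1 hab)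
  · exact (min_le_left _ _).trans_lt (hK.1.2 r)
  · rcases min_choice (K r) (L r) with h | h <;> rw [Pi.inf_apply, h] at hr ⊢
    · exact hK.2.1 r hr
    · exact hL.2.1 r hr
  · obtain ⟨r, hr⟩ := hK.2.2
    exact ⟨r, (min_le_left _ _).trans_lt hr⟩

theorem lt_of_mem_keySets (hk : 0 < k) {K : Fin k → ℕ} (hK : K ∈ keySets k n) :
    K ⟨0, hk⟩ < 2 * n := by
  obtain ⟨r, hr⟩ := hK.2.2
  exact (hK.1.1.monotone (Fin.le_def.mpr (Nat.zero_le _))).trans_lt hr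

theorem sup_mem_keySets {K L : Fin k → ℕ} (hK : K ∈ keySets k n) (hL : L ∈ keySets k n) :
    K ⊔ L ∈ keySets k n := by
  refine ⟨⟨fun a b hab => ?_, fun r => ?_⟩, fun r hr => ?_, ?_⟩
  · exact max_lt_max (hK.1.1 hab) (hL.1.1 hab)
  · exact max_lt (hK.1.2 r) (hL.1.2 r)
  · rcases max_choice (K r) (L r) with h | h <;> rw [Pi.sup_apply, h] at hr ⊢
    · exact hK.2.1 r hr
    · exact hL.2.1 r hr
  · have hk : 0 < k := by
      obtain ⟨r, _⟩ := hK.2.2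
      exact (Nat.zero_le _).trans_lt r.2
    exact ⟨⟨0, hk⟩, max_lt (lt_of_mem_keySets hk hK) (lt_of_mem_keySets hk hL)⟩

theorem tabMeet_eq {s t : List ℕ × List ℕ} (hs : isTab k (2 * n) s.1 s.2)
    (ht : isTab k (2 * n) t.1 t.2) :
    tabMeet k (2 * n) s t = tabOf k n (tabKey k n s ⊓ tabKey k n t) := by
  have h : List.zipWith min (xi k (2 * n) s.1 s.2) (xi k (2 * n) t.1 t.2) =
      List.ofFn fun r => (tabKey k n s ⊓ tabKey k n t) r + 1 := by
    rw [← ofFn_tabKey hs, ← ofFn_tabKey ht]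
    exact List.ext_getElem (by simp) fun i h1 h2 => by simp
  rw [tabMeet, tabOf, h]

theorem tabJoin_eq {s t : List ℕ × List ℕ} (hs : isTab k (2 * n) s.1 s.2)
    (ht : isTab k (2 * n) t.1 t.2) :
    tabJoin k (2 * n) s t = tabOf k n (tabKey k n s ⊔ tabKey k n t) := by
  have h : List.zipWith max (xi k (2 * n) s.1 s.2) (xi k (2 * n) t.1 t.2) =
      List.ofFn fun r => (tabKey k n s ⊔ tabKey k n t) r + 1 := by
    rw [← ofFn_tabKey hs, ← ofFn_tabKey ht]
    exact List.ext_getElem (by simp) fun i h1 h2 => by simp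
  rw [tabJoin, tabOf, h]

end Tableaux

section Assembly

variable {k n : ℕ}

theorem binWeight_inf_add_sup (K L : Fin k → ℕ) :
    binWeight (K ⊓ L) + binWeight (K ⊔ L) = binWeight K + binWeight L := by
  simp only [binWeight, ← Finset.sum_add_distrib]
  refine Finset.sum_congr rfl fun r _ => ?_
  rw [Pi.inf_apply, Pi.sup_apply]
  rcases le_total (K r) (L r) with h | h
  · rw [inf_eq_left.mpr h, sup_eq_right.mpr h]
  · rw [inf_eq_right.mpr h, sup_eq_left.mpr h, add_comm]

theorem binWeight_inf_lt {K L : Fin k → ℕ} (h : ¬ K ≤ L) : binWeight (K ⊓ L) < binWeight K := by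
  rw [Pi.le_def, not_forall] at h
  obtain ⟨r, hr⟩ := h
  refine Finset.sum_lt_sum (fun s _ => Nat.pow_le_pow_right two_pos inf_le_left)
    ⟨r, Finset.mem_univ _, Nat.pow_lt_pow_right one_lt_two ?_⟩
  exact (inf_le_right : (K ⊓ L) r ≤ L r).trans_lt (not_le.mp hr)

theorem binWeight_sq_add_sq_lt {K L : Fin k → ℕ} (h1 : ¬ K ≤ L) (h2 : ¬ L ≤ K) :
    binWeight K ^ 2 + binWeight L ^ 2 < binWeight (K ⊓ L) ^ 2 + binWeight (K ⊔ L) ^ 2 := by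
  have h := binWeight_inf_add_sup K L
  have hK := binWeight_inf_lt h1
  have hL := binWeight_inf_lt h2
  rw [inf_comm] at hL
  obtain ⟨a, ha⟩ := Nat.exists_eq_add_of_lt hK
  obtain ⟨b, hb⟩ := Nat.exists_eq_add_of_lt hL
  have hs : binWeight (K ⊔ L) = binWeight (K ⊓ L) + (a + 1) + (b + 1) := by omega
  rw [hs, ha, hb]
  nlinarith

theorem minorExponent_inf_add_sup (K L : Fin k → ℕ) :
    minorExponent n (K ⊓ L) + minorExponent n (K ⊔ L) = minorExponent n K + minorExponent n L := by
  simp only [minorExponent, ← Finset.sum_add_distrib]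
  refine Finset.sum_congr rfl fun r _ => ?_
  rw [Pi.inf_apply, Pi.sup_apply]
  rcases le_total (K r) (L r) with h | h
  · rw [inf_eq_left.mpr h, sup_eq_right.mpr h]
  · rw [inf_eq_right.mpr h, sup_eq_left.mpr h, add_comm]

theorem maxMinor_nullCol_of_forall_le {K : Fin k → ℕ} (hK : K ∈ columnSets k (2 * n + k))
    (h : ∀ r, 2 * n ≤ K r) : maxMinor (nullCol k n) K = 1 := by
  have hlow : ∀ m (hm : m < k), 2 * n + m ≤ K ⟨m, hm⟩ := by
    intro m
    induction m with
    | zero => intro hm; exact h _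
    | succ m ih =>
      intro hm
      have h1 := ih (by omega)
      have h2 : K ⟨m, by omega⟩ < K ⟨m + 1, hm⟩ := hK.1 (Fin.mk_lt_mk.mpr (Nat.lt_succ_self m))
      omega
  have hval : ∀ r : Fin k, K r = 2 * n + r := fun r =>
    (add_le_of_mem_columnSets hK r).antisymm (hlow r r.2)
  have h1 : (Matrix.of fun i => nullCol k n (K i)) = 1 := by
    ext i j
    rw [Matrix.of_apply, hval, nullCol_identity, Matrix.one_apply]
    simp only [eq_comm]
  change (Matrix.of fun i => nullCol k n (K i)).det = 1
  rw [h1, Matrix.det_one]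

/-- The set of one-line tableaux `D(N)` as a type. -/
abbrev NullTab (k n : ℕ) : Type := {s : List ℕ × List ℕ // isTabN k n s.1 s.2}

/-- The column tuple of an element of `D(N)`. -/
def NullTab.key (x : NullTab k n) : Fin k → ℕ := tabKey k n x.1

theorem NullTab.key_mem (x : NullTab k n) : x.key ∈ keySets k n := tabKey_mem x.2

/-- The element of `D(N)` with a given column tuple. -/
def NullTab.ofKey (K : Fin k → ℕ) (hK : K ∈ keySets k n) : NullTab k n :=
  ⟨tabOf k n K, isTabN_tabOf hK⟩

theorem NullTab.key_ofKey {K : Fin k → ℕ} (hK : K ∈ keySets k n) : (ofKey K hK).key = K :=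
  tabKey_tabOf hK

theorem NullTab.key_injective : Function.Injective (NullTab.key (k := k) (n := n)) := by
  intro x y h
  apply Subtype.ext
  rw [← tabOf_tabKey x.2.1, ← tabOf_tabKey y.2.1]
  exact congrArg _ h

/-- The meet in `D(N)`. -/
def NullTab.meet (x y : NullTab k n) : NullTab k n :=
  ofKey (x.key ⊓ y.key) (inf_mem_keySets x.key_mem y.key_mem)

/-- The join in `D(N)`. -/
def NullTab.join (x y : NullTab k n) : NullTab k n :=
  ofKey (x.key ⊔ y.key) (sup_mem_keySets x.key_mem y.key_mem)

theorem hVar_tabMeet (x y : NullTab k n) :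
    hVar (fun s => isTabN k n s.1 s.2) (tabMeet k (2 * n) x.1 y.1) = MvPolynomial.X (x.meet y) := by
  rw [tabMeet_eq x.2.1 y.2.1]
  exact dif_pos (x.meet y).2

theorem hVar_tabJoin (x y : NullTab k n) :
    hVar (fun s => isTabN k n s.1 s.2) (tabJoin k (2 * n) x.1 y.1) = MvPolynomial.X (x.join y) := by
  rw [tabJoin_eq x.2.1 y.2.1]
  exact dif_pos (x.join y).2

theorem hibiIdeal_eq_span : hibiIdeal (fun s => isTabN k n s.1 s.2) (tabMeet k (2 * n))
    (tabJoin k (2 * n)) = Ideal.span {f | ∃ x y : NullTab k n, f = MvPolynomial.X x *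
      MvPolynomial.X y - MvPolynomial.X (x.meet y) * MvPolynomial.X (x.join y)} := by
  simp only [hibiIdeal, hVar_tabMeet, hVar_tabJoin]

/-- Multisets of elements of `D(N)` whose elements are pairwise comparable. -/
def IsStandard (s : Multiset (NullTab k n)) : Prop :=
  ∀ x ∈ s, ∀ y ∈ s, x.key ≤ y.key ∨ y.key ≤ x.key

theorem mem_span_standard_coordinateRing
    (a : MvPolynomial (Fin k × Fin (2 * n)) ℂ ⧸ sympIdeal k n) :
    a ∈ Submodule.span ℂ {b | ∃ s : Multiset (NullTab k n), IsStandard s ∧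
      b = (s.map fun x => maxMinor (nullCol k n) x.key).prod} := by
  classical
  refine Submodule.span_mono ?_ (mem_span_chains nullCol_identity nullCol_isotropic
    adjoin_nullCol a)
  rintro _ ⟨t, ht, hc, rfl⟩
  have hk : ∀ K ∈ t.filter (∃ r, · r < 2 * n), K ∈ keySets k n := by
    intro K hK
    rw [Multiset.mem_filter] at hK
    exact ⟨(ht K hK.1).1, (ht K hK.1).2, hK.2⟩
  set u : Multiset (NullTab k n) := (t.filter (∃ r, · r < 2 * n)).pmap NullTab.ofKey hk with hu
  have hkey : u.map NullTab.key = t.filter (∃ r, · r < 2 * n) := by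
    rw [hu, Multiset.map_pmap]
    simp only [NullTab.key_ofKey]
    rw [Multiset.pmap_eq_map, Multiset.map_id']
  have hmem : ∀ x ∈ u, x.key ∈ t := fun x hx =>
    Multiset.mem_of_mem_filter (hkey ▸ Multiset.mem_map_of_mem NullTab.key hx)
  refine ⟨u, fun x hx y hy => hc _ (hmem x hx) _ (hmem y hy), ?_⟩
  rw [show (u.map fun x => maxMinor (nullCol k n) x.key) =
    (u.map NullTab.key).map (maxMinor (nullCol k n)) by
      rw [Multiset.map_map]; rfl, hkey]
  conv_lhs => rw [← Multiset.filter_add_not (∃ r, · r < 2 * n) t]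
  rw [Multiset.map_add, Multiset.prod_add]
  rw [Multiset.prod_eq_one (s := (t.filter fun K => ¬ ∃ r, K r < 2 * n).map _), mul_one]
  intro b hb
  obtain ⟨K, hK, rfl⟩ := Multiset.mem_map.mp hb
  rw [Multiset.mem_filter] at hK
  refine maxMinor_nullCol_of_forall_le (ht K hK.1).1 ?_
  simpa using hK.2

theorem mem_span_standard_hibi {J : Ideal (MvPolynomial (NullTab k n) ℂ)}
    (hJ : J = Ideal.span {f | ∃ x y : NullTab k n, f = MvPolynomial.X x *
      MvPolynomial.X y - MvPolynomial.X (x.meet y) * MvPolynomial.X (x.join y)})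
    (f : MvPolynomial (NullTab k n) ℂ ⧸ J) :
    f ∈ Submodule.span ℂ {b | ∃ s : Multiset (NullTab k n), IsStandard s ∧
      b = (s.map fun x => Ideal.Quotient.mk J (MvPolynomial.X x)).prod} := by
  set d : NullTab k n → MvPolynomial (NullTab k n) ℂ ⧸ J :=
    fun x => Ideal.Quotient.mk J (MvPolynomial.X x) with hd
  have hadj : f ∈ Algebra.adjoin ℂ (d '' Set.univ) := by
    obtain ⟨p, rfl⟩ := Ideal.Quotient.mk_surjective f
    induction p using MvPolynomial.induction_on with
    | C r => exact Subalgebra.algebraMap_mem _ r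
    | add p q hp hq => rw [map_add]; exact add_mem hp hq
    | mul_X p x hp =>
      rw [map_mul]
      exact mul_mem hp (Algebra.subset_adjoin ⟨x, trivial, rfl⟩)
  refine Submodule.span_le.mpr ?_ (mem_span_prod_of_mem_adjoin d _ hadj)
  rintro _ ⟨s, hs, rfl⟩
  refine Submodule.span_mono ?_ (prod_mem_span_chains d (fun x => binWeight x.key) Set.univ Set.univ
    (le := fun x y => x.key ≤ y.key) (fun x => le_rfl) (fun x _ => binWeight_le x.key_mem.1.2)
    (fun x _ h => absurd trivial h) (fun x _ y _ h1 h2 => Submodule.subset_span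
      ⟨x.meet y, trivial, x.join y, trivial, ?_, ?_⟩) s hs)
  · rintro _ ⟨t, _, ht, rfl⟩
    exact ⟨t, ht, rfl⟩
  · simp only [NullTab.meet, NullTab.join, NullTab.key_ofKey]
    exact binWeight_sq_add_sq_lt h1 h2
  · simp only [hd, ← map_mul]
    refine Ideal.Quotient.eq.mpr ?_
    rw [hJ]
    exact Ideal.subset_span ⟨x, y, rfl⟩

end Assembly

/-- The coordinate ring `R(𝒩_{k,2n}) = ℂ[M_{k,2n}]/I` of the nullcone is a
flat deformation of the Hibi algebra `H_{D(𝒩)}` : there is a flat `ℂ[t]`-algebra whose fiber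
at every `t = c ≠ 0` is `R(𝒩_{k,2n})` and whose fiber at `t = 0` is `H_{D(𝒩)}`. -/
theorem nullcone_flat_deformation_of_Hibi (k n : ℕ) (hk : 0 < k) (hn : 0 < n) :
    Nonempty (FlatDeform (MvPolynomial (Fin k × Fin (2 * n)) ℂ ⧸ sympIdeal k n)
      (MvPolynomial {s : List ℕ × List ℕ // isTabN k n s.1 s.2} ℂ ⧸
        hibiIdeal (fun s => isTabN k n s.1 s.2) (tabMeet k (2 * n)) (tabJoin k (2 * n)))) := by
  refine flatDeform_of_leading (wt := varWeight k n) (φ := nullParam k n) (D := NullTab k n)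
    (δ := fun x => maxMinor (nullCol k n) x.key) (μ := fun x => minorExponent n x.key)
    (std := IsStandard) (fun x => ?_)
    (fun x => weight_minorExponent_pos hk x.key_mem.1 (lt_of_mem_keySets hk x.key_mem))
    (fun s t hs ht h => ?_) (mt := NullTab.meet) (jn := NullTab.join) (fun x y => ?_)
    mem_span_standard_coordinateRing hibiIdeal_eq_span (mem_span_standard_hibi hibiIdeal_eq_span)
  · rw [nullParam_maxMinor x.key_mem.1.2]
    exact isLead_maxMinor_echelon x.key_mem.1 x.key_mem.2.1
  · have hlt : ∀ s : Multiset (NullTab k n), ∀ K ∈ s.map NullTab.key, K ⟨0, hk⟩ < 2 * n := by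
      intro s K hK
      obtain ⟨x, _, rfl⟩ := Multiset.mem_map.mp hK
      exact lt_of_mem_keySets hk x.key_mem
    have hch : ∀ s : Multiset (NullTab k n), IsStandard s → ∀ K ∈ s.map NullTab.key,
        ∀ L ∈ s.map NullTab.key, K ≤ L ∨ L ≤ K := by
      intro s hs K hK L hL
      obtain ⟨x, hx, rfl⟩ := Multiset.mem_map.mp hK
      obtain ⟨y, hy, rfl⟩ := Multiset.mem_map.mp hL
      exact hs x hx y hy
    refine Multiset.map_injective NullTab.key_injective (eq_of_sum_map_minorExponent_eq (n := n) hk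
      (hlt s) (hlt t) (hch s hs) (hch t ht) ?_)
    rw [Multiset.map_map, Multiset.map_map]
    exact h
  · simp only [NullTab.meet, NullTab.join, NullTab.key_ofKey]
    exact minorExponent_inf_add_sup _ _

end
end

section
/- Let t be an N-standard tableau with one-line tableaux [I_1:J_1] ⪯ … ⪯ [I_u:J_u] in D(N), and let p_t = Σ_r p_{ξ([I_r:J_r])} ∈ P(k,2n) be the corresponding pattern, regarded via its class in P_{k,2n} as an order-preserving map on Γ_{k,2n}. Then the support of p_t is contained in Ϝ_{k,2n} = Γ_{k,2n} \ (A ∪ B), where A = {z_b^{(a)} ∈ Γ_{2n+k} : a ≤ 2n and b > (a+1)/2} and B = {z_b^{(a)} ∈ Γ_{2n+k} : z_b^{(a)} ≤ z_{min(k,n)+1}^{(2n)}}. -/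
noncomputable section

/-- `inGT m (i,j)` : `z_j^{(i)}` is a point of the Gelfand–Tsetlin poset Γ_m. -/
def inGT (m : ℕ) (z : ℕ × ℕ) : Prop := 1 ≤ z.2 ∧ z.2 ≤ z.1 ∧ z.1 ≤ m

/-- The Gelfand–Tsetlin order: `gtLE (a,b) (i,j)` means `z_b^{(a)} ≤ z_j^{(i)}` in the partial
order generated by `z_j^{(i+1)} ≥ z_j^{(i)} ≥ z_{j+1}^{(i+1)}`. -/
def gtLE (z w : ℕ × ℕ) : Prop := w.2 ≤ z.2 ∧ z.1 + w.2 ≤ w.1 + z.2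

/-- `pCol m J` is the GT pattern of `GL_m` corresponding (via the bijection of
[pattern2tableau]) to the single-column semistandard tableau with entries `J`. -/
def pCol (m : ℕ) (J : List ℕ) : ℕ × ℕ → ℕ := fun z =>
  if 1 ≤ z.2 ∧ z.2 ≤ z.1 ∧ z.1 ≤ m ∧ z.2 ≤ J.countP (fun x => decide (x ≤ z.1)) then 1 else 0

/-- The poset `Γ_{n,m} = Γ_{m+n}^n \\ {z : z ≥ z_n^{(m+n)}}`. -/
def GammaSet (n m : ℕ) : Set (ℕ × ℕ) :=
  {z | inGT (m + n) z ∧ z.2 ≤ n ∧ ¬ gtLE (m + n, n) z}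

/-- The poset `Ϝ_{k,2n} = Γ_{k,2n} \\ (A ∪ B)`. -/
def Fset (k n : ℕ) : Set (ℕ × ℕ) :=
  {z | z ∈ GammaSet k (2 * n) ∧ ¬ (z.1 ≤ 2 * n ∧ z.1 + 1 < 2 * z.2) ∧
    ¬ gtLE z (2 * n, min k n + 1)}

theorem countP_range_add_sub_le (m a k : ℕ) :
    (List.range k).countP (fun i => decide (m + (k - i) ≤ a)) ≤ min k (a - m) := by
  induction k with
  | zero => simp
  | succ k ih =>
    rw [List.range_succ_eq_map, List.countP_cons, List.countP_map]
    have h : ((fun i => decide (m + (k + 1 - i) ≤ a)) ∘ Nat.succ) =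
        fun i => decide (m + (k - i) ≤ a) := by
      funext i
      simp
    rw [h]
    split_ifs with h0
    · simp only [Nat.sub_zero, decide_eq_true_eq] at h0
      omega
    · omega

theorem countP_xi_le (k m a : ℕ) (I J : List ℕ) :
    (xi k m I J).countP (fun x => decide (x ≤ a)) ≤
      J.countP (fun x => decide (x ≤ a)) + (a - m) := by
  unfold xi
  rw [List.countP_append, List.countP_map, List.countP_reverse]
  refine Nat.add_le_add_left ?_ _
  refine (List.filter_sublist.countP_le).trans ?_
  rw [List.countP_map]
  have h : (((fun x => decide (x ≤ a)) ∘ fun c => m + (k + 1 - c)) ∘ fun c => c + 1) =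
      fun i => decide (m + (k - i) ≤ a) := by
    funext i
    simp
  rw [h]
  exact (countP_range_add_sub_le m a k).trans (min_le_right _ _)

/-- If every entry satisfying `p` has index less than `c`, then at most `c` entries do. -/
theorem List.countP_le_of_index_lt (p : ℕ → Bool) (J : List ℕ) (c : ℕ)
    (h : ∀ r (hr : r < J.length), p J[r] → r < c) : J.countP p ≤ c := by
  have hdrop : (J.drop c).countP p = 0 := by
    rw [List.countP_eq_zero]
    intro x hx hpx
    obtain ⟨i, hi, rfl⟩ := List.mem_iff_getElem.mp hx
    rw [List.getElem_drop] at hpx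
    have := h _ _ hpx
    omega
  have htake : (J.take c).countP p ≤ c :=
    List.countP_le_length.trans (List.length_take_le c J)
  rw [← List.take_append_drop c J, List.countP_append]
  omega

theorem Jtilde.countP_le {n : ℕ} {J : List ℕ} (hJ : Jtilde n J) (a : ℕ) :
    J.countP (fun x => decide (x ≤ a)) ≤ (a + 1) / 2 := by
  refine J.countP_le_of_index_lt _ _ fun r hr h => ?_
  have h1 := hJ.2 r hr
  rw [List.getD_eq_getElem _ _ hr] at h1
  simp only [decide_eq_true_eq] at h
  omega

/-- Proposition `support`. For an `𝒩`-standard tableau `t` with one-line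
tableaux `[I₁:J₁] ⪯ ⋯ ⪯ [I_u:J_u]` in `D(𝒩)`, the corresponding pattern
`p_t = ∑_r p_{ξ([I_r:J_r])}`, regarded as an order preserving map on `Γ_{k,2n}`, is
supported in `Ϝ_{k,2n} = Γ_{k,2n} \ (A ∪ B)`. -/
theorem N_standard_pattern_support (k n : ℕ) (hk : 0 < k) (hn : 0 < n)
    (L : List (List ℕ × List ℕ)) (hL : ∀ t ∈ L, isTabN k n t.1 t.2)
    (hchain : L.Chain' tleq) :
    ∀ z : ℕ × ℕ, z ∈ GammaSet k (2 * n) →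
      (L.map fun t => pCol (2 * n + k) (xi k (2 * n) t.1 t.2) z).sum ≠ 0 →
      z ∈ Fset k n := by
  rintro ⟨a, b⟩ hz hsum
  obtain ⟨x, hx, hx0⟩ : ∃ x ∈ L.map fun t => pCol (2 * n + k) (xi k (2 * n) t.1 t.2) (a, b),
      x ≠ 0 := by
    by_contra! h
    exact hsum (List.sum_eq_zero h)
  obtain ⟨⟨I, J⟩, ht, rfl⟩ := List.mem_map.mp hx
  obtain ⟨⟨hlen, -⟩, hmin, hJ⟩ := hL _ ht
  have hcount : b ≤ (xi k (2 * n) I J).countP (fun x => decide (x ≤ a)) := by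
    by_contra h
    exact hx0 (if_neg fun h' => h h'.2.2.2)
  have hxi := countP_xi_le k (2 * n) a I J
  have hodd := hJ.countP_le a
  have hlength : J.countP (fun x => decide (x ≤ a)) ≤ J.length := List.countP_le_length
  simp only at hlen hmin hodd
  refine ⟨hz, ?_, ?_⟩
  · rintro ⟨h1, h2⟩
    simp only at h1 h2
    omega
  · rintro ⟨h1, h2⟩
    simp only at h1 h2
    omega

end
end

section
/- Let [I:J] ∈ D(k,2n) and let K = ξ([I:J]) ∈ Pl(k,2n+k), with p_K the GT pattern of GL_{2n+k} corresponding to K. Then the intersection supp(p_K) ∩ {z_b^{(a)} ∈ Γ_{2n+k} : a ≤ 2n and b > (a+1)/2} is nonempty if and only if J ⋡ J̃. -/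
noncomputable section

/-- In a sorted list, the entries that are at most `a` are exactly those at the first positions. -/
theorem lt_countP_le_iff {l : List ℕ} (hl : l.Pairwise (· < ·)) (a r : ℕ) :
    r < l.countP (fun x => decide (x ≤ a)) ↔ r < l.length ∧ l.getD r 0 ≤ a := by
  induction l generalizing r with
  | nil => simp
  | cons x l ih =>
    obtain ⟨hx, hl⟩ := List.pairwise_cons.1 hl
    by_cases hxa : x ≤ a
    · cases r with
      | zero => simp [hxa]
      | succ r => simpa [List.countP_cons, hxa] using ih hl r
    · have hcount : (x :: l).countP (fun y => decide (y ≤ a)) = 0 := by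
        rw [List.countP_eq_zero]
        intro y hy
        rcases List.mem_cons.1 hy with rfl | hy
        · simpa using hxa
        · have := hx y hy
          simp only [decide_eq_true_eq]
          omega
      rw [hcount]
      refine iff_of_false (Nat.not_lt_zero r) fun ⟨hr, hra⟩ => ?_
      rw [List.getD_eq_getElem _ _ hr] at hra
      have hpos := List.countP_eq_zero.1 hcount _ (List.getElem_mem hr)
      simp only [decide_eq_true_eq] at hpos
      exact hpos hra

/-- The entries that `xi` appends to `J` all exceed `m`. -/
theorem countP_xi_of_le {n m a : ℕ} (I J : List ℕ) (ha : a ≤ m) :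
    (xi n m I J).countP (fun x => decide (x ≤ a)) = J.countP (fun x => decide (x ≤ a)) := by
  rw [xi, List.countP_append, Nat.add_eq_left, List.countP_eq_zero]
  intro y hy
  simp only [List.mem_map, List.mem_reverse, List.mem_filter, List.mem_range] at hy
  obtain ⟨c, ⟨⟨d, hd, rfl⟩, -⟩, rfl⟩ := hy
  simp only [decide_eq_true_eq]
  omega

/-- For `[I:J] ∈ D(k,2n)` and `K = ξ([I:J]) ∈ Pl(k,2n+k)`, the support of
the GT pattern `p_K` meets `{z_b^{(a)} ∈ Γ_{2n+k} : a ≤ 2n and b > (a+1)/2}` if and only if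
`J ⋡ J̃`. -/
theorem support_meets_A_iff_not_Jtilde (k n : ℕ) (hk : 0 < k) (hn : 0 < n)
    (I J : List ℕ) (h : isTab k (2 * n) I J) :
    (∃ z : ℕ × ℕ, inGT (2 * n + k) z ∧ z.1 ≤ 2 * n ∧ z.1 + 1 < 2 * z.2 ∧
      pCol (2 * n + k) (xi k (2 * n) I J) z ≠ 0) ↔ ¬ Jtilde n J := by
  obtain ⟨-, -, -, hJ, -, hmem⟩ := h
  have hcount := lt_countP_le_iff (List.isChain_iff_pairwise.1 hJ)
  constructor
  · rintro ⟨⟨a, b⟩, ⟨hb, -, -⟩, ha, hab, hp⟩ ⟨-, hJt⟩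
    simp only [pCol, ne_eq, ite_eq_right_iff, one_ne_zero, imp_false, not_not] at hp hb ha hab
    rw [countP_xi_of_le I J ha] at hp
    obtain ⟨hlen, hle⟩ := (hcount a (b - 1)).1 (by omega)
    have := hJt _ hlen
    omega
  · intro hJt
    obtain ⟨r, hrn, hr, hle⟩ : ∃ r ≤ n, r < J.length ∧ J.getD r 0 ≤ 2 * r := by
      by_cases hlen : J.length ≤ n
      · simp only [Jtilde, hlen, true_and, not_forall] at hJt
        obtain ⟨r, hr, hlt⟩ := hJt
        exact ⟨r, by omega, hr, by omega⟩
      · have hn' : n < J.length := by omega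
        refine ⟨n, le_rfl, hn', ?_⟩
        rw [List.getD_eq_getElem _ _ hn']
        exact (hmem _ (List.getElem_mem hn')).2
    have hpos : 1 ≤ J.getD r 0 := by
      rw [List.getD_eq_getElem _ _ hr]
      exact (hmem _ (List.getElem_mem hr)).1
    have hr' := (hcount (2 * r) r).2 ⟨hr, hle⟩
    have ha : 2 * r ≤ 2 * n := by omega
    refine ⟨(2 * r, r + 1), ⟨?_, ?_, ?_⟩, ha, ?_, ?_⟩
    any_goals grind
    simp only [pCol, countP_xi_of_le I J ha, ne_eq, ite_eq_right_iff, one_ne_zero, imp_false,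
      not_not]
    omega

end
end
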